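/- arXiv:2012.07933 — 15 statements merged into one kernel-verified Lean document; each statement's English description precedes it below -/
import Mathlib

section
/- Let ν be a Borel probability measure on (0,∞) with continuous CDF F(w) = ν((0,w]), and suppose there exist ω̄ > 0, λ ∈ (0,1) and constants 1 < γ₁ < γ₂ such that γ₁·F(λw) ≤ F(w) ≤ γ₂·F(λw) and F(w) > 0 for all w ∈ (0,ω̄). Let p ∈ (0,1], C > 0, and let α > 0 be defined by λ^α = 1/γ₂. Then there exists a constant K > 0, depending only on ν, ω̄, λ, γ₁, γ₂, p and C (but not on T), such that for every real T > 0 for which there exists μ_T ∈ (0,ω̄) with p·∫_{(0,μ_T]} u dν(u) = C/T, one has T·p·F(μ_T) ≥ K·T^{1/(1+α)}. -/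
open MeasureTheory

/-- quantitative lower bound `T·p·F(μ_T) ≥ K·T^{1/(1+α)}` where the
threshold `μ_T ∈ (0,ω̄)` is determined by `p·∫_{(0,μ_T]} u dν(u) = C/T`. -/
theorem stmt1
    (ν : Measure ℝ) [IsProbabilityMeasure ν] (hsupp : ν (Set.Iic 0) = 0)
    (F : ℝ → ℝ) (hF : ∀ w, F w = (ν (Set.Ioc 0 w)).toReal) (hFcont : Continuous F)
    (ob lam γ₁ γ₂ : ℝ) (hω : 0 < ob) (hlam : lam ∈ Set.Ioo (0:ℝ) 1)
    (hγ₁ : 1 < γ₁) (hγ₁₂ : γ₁ < γ₂)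
    (hreg : ∀ w ∈ Set.Ioo 0 ob, γ₁ * F (lam * w) ≤ F w ∧ F w ≤ γ₂ * F (lam * w))
    (hpos : ∀ w ∈ Set.Ioo 0 ob, 0 < F w)
    (p C : ℝ) (hp : 0 < p) (hp1 : p ≤ 1) (hC : 0 < C)
    (α : ℝ) (hα : 0 < α) (hαdef : lam ^ α = 1 / γ₂) :
    ∃ K : ℝ, 0 < K ∧ ∀ T : ℝ, 0 < T → ∀ μT ∈ Set.Ioo 0 ob,
      p * ∫ u in Set.Ioc 0 μT, u ∂ν = C / T →
      K * T ^ (1 / (1 + α)) ≤ T * p * F μT := by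
  obtain ⟨hl0, hl1⟩ := hlam
  have hγ₂ : 0 < γ₂ := by linarith
  have hmono : ∀ a b, a ≤ b → F a ≤ F b := by
    intro a b hab
    rw [hF, hF]
    exact ENNReal.toReal_mono (measure_ne_top _ _)
      (measure_mono (Set.Ioc_subset_Ioc_right hab))
  have hb : ob / 2 ∈ Set.Ioo 0 ob := ⟨by linarith, by linarith⟩
  have hFb := hpos _ hb
  have hiter : ∀ n : ℕ, (lam ^ n) ^ α * F (ob / 2) ≤ F (lam ^ n * (ob / 2)) := by
    intro n
    induction n with
    | zero => simp
    | succ n ih =>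
      have hn0 : 0 < lam ^ n := pow_pos hl0 n
      have hn1 : lam ^ n ≤ 1 := pow_le_one₀ hl0.le hl1.le
      have hmem : lam ^ n * (ob / 2) ∈ Set.Ioo 0 ob :=
        ⟨mul_pos hn0 hb.1, by nlinarith⟩
      have h2 := (hreg _ hmem).2
      have e : lam * (lam ^ n * (ob / 2)) = lam ^ (n + 1) * (ob / 2) := by ring
      rw [e] at h2
      have e2 : (lam ^ (n + 1)) ^ α = (lam ^ n) ^ α * (1 / γ₂) := by
        rw [pow_succ, Real.mul_rpow hn0.le hl0.le, hαdef]
      rw [e2]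
      have e3 : (lam ^ n) ^ α * (1 / γ₂) * F (ob / 2)
          = ((lam ^ n) ^ α * F (ob / 2)) / γ₂ := by ring
      rw [e3, div_le_iff₀ hγ₂]
      linarith
  have hlow : ∀ w ∈ Set.Ioo 0 ob, F (ob / 2) * (lam / ob) ^ α * w ^ α ≤ F w := by
    intro w hw
    have hex : ∃ n : ℕ, lam ^ n * (ob / 2) ≤ w := by
      obtain ⟨n, hn⟩ := exists_pow_lt_of_lt_one (div_pos hw.1 hb.1) hl1
      exact ⟨n, ((lt_div_iff₀ hb.1).1 hn).le⟩
    classical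
    have hn := Nat.find_spec hex
    have key : lam / ob * w ≤ lam ^ (Nat.find hex) := by
      rw [div_mul_eq_mul_div, div_le_iff₀ hω]
      rcases hk : Nat.find hex with _ | m
      · simp only [pow_zero]
        nlinarith [hw.1, hw.2]
      · have := Nat.find_min hex (m := m) (by omega)
        push Not at this
        have hm0 : 0 < lam ^ m := pow_pos hl0 m
        have : w ≤ lam ^ m * ob := by nlinarith
        calc lam * w ≤ lam * (lam ^ m * ob) := by gcongr
          _ = lam ^ (m + 1) * ob := by ring
    have hlo : 0 < lam / ob := div_pos hl0 hω
    calc F (ob / 2) * (lam / ob) ^ α * w ^ α = (lam / ob * w) ^ α * F (ob / 2) := by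
          rw [Real.mul_rpow hlo.le hw.1.le]; ring
      _ ≤ (lam ^ (Nat.find hex)) ^ α * F (ob / 2) := by
          apply mul_le_mul_of_nonneg_right _ hFb.le
          exact Real.rpow_le_rpow (mul_pos hlo hw.1).le key hα.le
      _ ≤ _ := hiter _
      _ ≤ F w := hmono _ _ hn
  have hc : 0 < F (ob / 2) * (lam / ob) ^ α :=
    mul_pos hFb (Real.rpow_pos_of_pos (div_pos hl0 hω) _)
  generalize F (ob / 2) * (lam / ob) ^ α = c at hlow hc
  have hD : 0 < C ^ α * p * c := by positivity
  refine ⟨(C ^ α * p * c) ^ (1 / (1 + α)), by positivity, ?_⟩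
  intro T hT m hm hint
  have hFm := hpos m hm
  have hI : ∫ u in Set.Ioc 0 m, u ∂ν ≤ m * F m := by
    have h1 : ∫ u in Set.Ioc 0 m, u ∂ν ≤ ∫ u in Set.Ioc 0 m, m ∂ν := by
      apply setIntegral_mono_on _ _ measurableSet_Ioc (fun x hx => hx.2)
      · exact (continuous_id.integrableOn_Icc (a := 0) (b := m)).mono_set
          Set.Ioc_subset_Icc_self
      · exact integrable_const _
    rw [setIntegral_const, smul_eq_mul, measureReal_def, ← hF] at h1
    linarith
  have hX1 : C / m ≤ T * p * F m := by
    rw [div_le_iff₀ hm.1]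
    have h2 : C / T ≤ p * (m * F m) := by
      rw [← hint]; exact mul_le_mul_of_nonneg_left hI hp.le
    rw [div_le_iff₀ hT] at h2
    linarith
  have hX2 : T * p * (c * m ^ α) ≤ T * p * F m :=
    mul_le_mul_of_nonneg_left (hlow m hm) (by positivity)
  have hXpos : 0 < T * p * F m := by positivity
  generalize T * p * F m = X at hX1 hX2 hXpos
  have hm0 := hm.1
  have hmain : C ^ α * p * c * T ≤ X ^ (1 + α) := by
    rw [Real.rpow_add hXpos, Real.rpow_one]
    have h3 : (C / m) ^ α ≤ X ^ α := Real.rpow_le_rpow (by positivity) hX1 hα.le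
    have h4 : T * p * (c * m ^ α) * (C / m) ^ α ≤ X * X ^ α := by gcongr
    refine le_trans (le_of_eq ?_) h4
    rw [Real.div_rpow hC.le hm0.le]
    have : 0 < m ^ α := by positivity
    field_simp
  rw [← Real.mul_rpow hD.le hT.le]
  calc (C ^ α * p * c * T) ^ (1 / (1 + α)) ≤ (X ^ (1 + α)) ^ (1 / (1 + α)) :=
        Real.rpow_le_rpow (by positivity) hmain (by positivity)
    _ = X := by
        rw [← Real.rpow_mul hXpos.le, mul_one_div_cancel (by positivity), Real.rpow_one]
end

section
/- Let n ≥ 1, let p_1,…,p_n > 0 with Σ_i p_i ≤ 1, let r_1,…,r_n ∈ (0,1], and let ν_1,…,ν_n be Borel probability measures on (0,∞) with continuous CDFs F_i(w) = ν_i((0,w]), each satisfying, with common constants ω̄ > 0, λ ∈ (0,1), 1 < γ₁ < γ₂: γ₁·F_i(λw) ≤ F_i(w) ≤ γ₂·F_i(λw) and F_i(w) > 0 for all w ∈ (0,ω̄). Let C > 0, let α > 0 be defined by λ^α = 1/γ₂, and assume D := Σ_{i=1}^n p_i·r_i·F_i(r_i·ω̄) > 0. Then there exists a constant K > 0, depending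 only on ω̄, λ, γ₁, γ₂, C and D — in particular not on n and not on T — such that for every real T > 0 for which there exists μ_T ∈ (0,ω̄) with Σ_{i=1}^n p_i·∫_{(0, r_i·μ_T]} u dν_i(u) = C/T, one has T·Σ_{i=1}^n p_i·r_i·F_i(r_i·μ_T) ≥ K·T^{1/(1+α)}. -/
open MeasureTheory

lemma aux_iter (ob lam γ₂ : ℝ) (hω : 0 < ob) (hlam : lam ∈ Set.Ioo (0:ℝ) 1)
    (hγ₂ : 1 < γ₂) (α : ℝ) (hα : 0 < α) (hαdef : lam ^ α = 1 / γ₂)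
    (F : ℝ → ℝ) (hF : Continuous F) (hmono : Monotone F) (h0 : ∀ w, 0 ≤ F w)
    (hg : ∀ w ∈ Set.Ioo 0 ob, F w ≤ γ₂ * F (lam * w))
    (r : ℝ) (hr : 0 < r ∧ r ≤ 1) (μ : ℝ) (hμ : μ ∈ Set.Ioo 0 ob) :
    (μ / ob) ^ α * F (r * ob) ≤ γ₂ * F (r * μ) := by
  obtain ⟨hl0, hl1⟩ := hlam
  obtain ⟨hμ0, hμ1⟩ := hμ
  have hg' : ∀ w ∈ Set.Ioc 0 ob, F w ≤ γ₂ * F (lam * w) := by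
    intro w hw
    have hcl : IsClosed {w | F w ≤ γ₂ * F (lam * w)} :=
      isClosed_le hF (by fun_prop)
    have h1 : closure (Set.Ioo 0 ob) ⊆ {w | F w ≤ γ₂ * F (lam * w)} :=
      hcl.closure_subset_iff.2 hg
    rw [closure_Ioo hω.ne] at h1
    exact h1 ⟨hw.1.le, hw.2⟩
  have hγ0 : 0 < γ₂ := by linarith
  have hit : ∀ k : ℕ, F (r * ob) ≤ γ₂ ^ k * F (lam ^ k * (r * ob)) := by
    intro k
    induction k with
    | zero => simp
    | succ k ih =>
      have hp : 0 < lam ^ k := pow_pos hl0 k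
      have hp1 : lam ^ k ≤ 1 := pow_le_one₀ hl0.le hl1.le
      have hro : 0 < r * ob := mul_pos hr.1 hω
      have hro1 : r * ob ≤ ob := by nlinarith [hr.2]
      have h2 := hg' (lam ^ k * (r * ob)) ⟨by positivity, by nlinarith⟩
      calc _ ≤ _ := ih
        _ ≤ γ₂ ^ k * (γ₂ * F (lam * (lam ^ k * (r * ob)))) := by gcongr
        _ = _ := by rw [pow_succ, pow_succ', mul_assoc, mul_assoc]
  have hx0 : 0 < μ / ob := div_pos hμ0 hω
  obtain ⟨k, hk1, hk2⟩ := exists_nat_pow_near_of_lt_one hx0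
    ((div_le_one hω).2 hμ1.le) hl0 hl1
  have h3 : F (r * ob) ≤ γ₂ ^ (k + 1) * F (r * μ) := by
    refine (hit (k + 1)).trans ?_
    have : lam ^ (k + 1) * (r * ob) ≤ r * μ := by
      have := (lt_div_iff₀ hω).1 hk1
      nlinarith [hr.1]
    gcongr
    exact hmono this
  have h4 : (μ / ob) ^ α * γ₂ ^ k ≤ 1 := by
    have : (μ / ob) ^ α ≤ (1 / γ₂) ^ k := by
      rw [← hαdef]
      calc (μ / ob) ^ α ≤ (lam ^ k) ^ α := Real.rpow_le_rpow hx0.le hk2 hα.le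
        _ = (lam ^ α) ^ k := by
          rw [← Real.rpow_natCast, ← Real.rpow_natCast, ← Real.rpow_mul hl0.le,
            ← Real.rpow_mul hl0.le, mul_comm]
    calc _ ≤ (1 / γ₂) ^ k * γ₂ ^ k := by gcongr
      _ = 1 := by rw [← mul_pow, one_div, inv_mul_cancel₀ hγ0.ne', one_pow]
  have hxa : 0 < (μ / ob) ^ α := Real.rpow_pos_of_pos hx0 _
  calc (μ / ob) ^ α * F (r * ob) ≤ (μ / ob) ^ α * (γ₂ ^ (k + 1) * F (r * μ)) := by gcongr
    _ = ((μ / ob) ^ α * γ₂ ^ k) * (γ₂ * F (r * μ)) := by rw [pow_succ]; ring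
    _ ≤ 1 * (γ₂ * F (r * μ)) := by
      have := h0 (r * μ)
      gcongr
    _ = _ := one_mul _

lemma aux_int (ν : Measure ℝ) [IsProbabilityMeasure ν] (a : ℝ) :
    ∫ u in Set.Ioc 0 a, u ∂ν ≤ a * (ν (Set.Ioc 0 a)).toReal := by
  have hi : IntegrableOn (fun u : ℝ => u) (Set.Ioc 0 a) ν := by
    refine (continuous_id.integrableOn_Icc (a := 0) (b := a)).mono_set Set.Ioc_subset_Icc_self
  calc ∫ u in Set.Ioc 0 a, u ∂ν ≤ ∫ u in Set.Ioc 0 a, a ∂ν :=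
        setIntegral_mono_on hi (integrable_const a).integrableOn measurableSet_Ioc (fun u hu => hu.2)
    _ = _ := by simp [Measure.real, mul_comm]

/-- quantitative lower bound `T·Σᵢ pᵢ·rᵢ·Fᵢ(rᵢ·μ_T) ≥ K·T^{1/(1+α)}`
with a constant `K` depending only on `ω̄, λ, γ₁, γ₂, C, D` (not on `n`, not on `T`). -/
theorem stmt2
    (ob lam γ₁ γ₂ C D : ℝ) (hω : 0 < ob) (hlam : lam ∈ Set.Ioo (0:ℝ) 1)
    (hγ₁ : 1 < γ₁) (hγ₁₂ : γ₁ < γ₂) (hC : 0 < C) (hD : 0 < D)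
    (α : ℝ) (hα : 0 < α) (hαdef : lam ^ α = 1 / γ₂) :
    ∃ K : ℝ, 0 < K ∧
      ∀ (n : ℕ), 1 ≤ n → ∀ (p r : Fin n → ℝ) (ν : Fin n → Measure ℝ) (F : Fin n → ℝ → ℝ),
        (∀ i, IsProbabilityMeasure (ν i)) →
        (∀ i, ν i (Set.Iic 0) = 0) →
        (∀ i w, F i w = (ν i (Set.Ioc 0 w)).toReal) →
        (∀ i, Continuous (F i)) →
        (∀ i, 0 < p i) → (∑ i, p i ≤ 1) →
        (∀ i, 0 < r i ∧ r i ≤ 1) →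
        (∀ i, ∀ w ∈ Set.Ioo 0 ob,
          (γ₁ * F i (lam * w) ≤ F i w ∧ F i w ≤ γ₂ * F i (lam * w)) ∧ 0 < F i w) →
        (∑ i, p i * r i * F i (r i * ob) = D) →
        ∀ T : ℝ, 0 < T → ∀ μT ∈ Set.Ioo 0 ob,
          (∑ i, p i * ∫ u in Set.Ioc 0 (r i * μT), u ∂(ν i)) = C / T →
          K * T ^ (1 / (1 + α)) ≤ T * ∑ i, p i * r i * F i (r i * μT) := by
  have hγ0 : 0 < γ₂ := by linarith
  have hob : 0 < ob ^ α := Real.rpow_pos_of_pos hω _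
  have hCa : 0 < C ^ α := Real.rpow_pos_of_pos hC _
  set c : ℝ := D / γ₂ / ob ^ α with hc
  have hc0 : 0 < c := by positivity
  have h1α : 0 < 1 + α := by linarith
  refine ⟨(c * C ^ α) ^ (1 / (1 + α)), Real.rpow_pos_of_pos (by positivity) _, ?_⟩
  intro n hn p r ν F hν hν0 hF hFc hp hps hr hreg hDs T hT μ hμ hint
  have hFn : ∀ i w, 0 ≤ F i w := fun i w => by rw [hF]; exact ENNReal.toReal_nonneg
  have hmono : ∀ i, Monotone (F i) := by
    intro i a b hab
    have := hν i
    rw [hF, hF]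
    exact ENNReal.toReal_mono (measure_ne_top _ _)
      (measure_mono (Set.Ioc_subset_Ioc_right hab))
  set G : ℝ := ∑ i, p i * r i * F i (r i * μ) with hG
  have hμ0 : 0 < μ := hμ.1
  have hA : C / T ≤ μ * G := by
    rw [← hint, hG, Finset.mul_sum]
    refine Finset.sum_le_sum fun i _ => ?_
    have := hν i
    have h := aux_int (ν i) (r i * μ)
    rw [← hF] at h
    calc _ ≤ p i * (r i * μ * F i (r i * μ)) := mul_le_mul_of_nonneg_left h (hp i).le
      _ = _ := by ring
  have hB : (μ / ob) ^ α * D ≤ γ₂ * G := by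
    rw [← hDs, hG, Finset.mul_sum, Finset.mul_sum]
    refine Finset.sum_le_sum fun i _ => ?_
    have h := aux_iter ob lam γ₂ hω hlam (hγ₁.trans hγ₁₂) α hα hαdef (F i) (hFc i) (hmono i)
      (hFn i) (fun w hw => (hreg i w hw).1.2) (r i) (hr i) μ hμ
    have hpr : 0 ≤ p i * r i := mul_nonneg (hp i).le (hr i).1.le
    nlinarith [mul_le_mul_of_nonneg_left h hpr]
  have hCT : 0 < C / T := by positivity
  have hG0 : 0 < G := by
    by_contra hcon
    nlinarith
  have hB' : c * μ ^ α ≤ G := by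
    rw [Real.div_rpow hμ0.le hω.le] at hB
    have : c * μ ^ α = (μ ^ α / ob ^ α * D) / γ₂ := by rw [hc]; field_simp
    rw [this, div_le_iff₀ hγ0]
    linarith
  have hGa : 0 < G ^ α := Real.rpow_pos_of_pos hG0 _
  have hTa : 0 < T ^ α := Real.rpow_pos_of_pos hT _
  have hE : C ^ α ≤ T ^ α * (μ ^ α * G ^ α) := by
    have h := Real.rpow_le_rpow hCT.le hA hα.le
    rw [Real.div_rpow hC.le hT.le, Real.mul_rpow hμ0.le hG0.le, div_le_iff₀ hTa] at h
    linarith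
  have key : c * C ^ α * T ≤ (T * G) ^ (1 + α) := by
    rw [Real.rpow_add (by positivity), Real.rpow_one, Real.mul_rpow hT.le hG0.le]
    calc c * C ^ α * T ≤ c * (T ^ α * (μ ^ α * G ^ α)) * T := by gcongr
      _ = (c * μ ^ α) * (T * (T ^ α * G ^ α)) := by ring
      _ ≤ G * (T * (T ^ α * G ^ α)) := by gcongr
      _ = _ := by ring
  rw [← Real.mul_rpow (by positivity) hT.le]
  calc _ ≤ ((T * G) ^ (1 + α)) ^ (1 / (1 + α)) :=
        Real.rpow_le_rpow (by positivity) key (by positivity)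
    _ = T * G := by
      rw [← Real.rpow_mul (by positivity), mul_one_div_cancel h1α.ne', Real.rpow_one]
end

section
/- Let ν be a Borel probability measure on (0,∞) with continuous CDF F(w) = ν((0,w]) and finite mean. Let p ∈ (0,1], T' > 0, m ≥ 1, rewards r_1 ≥ r_2 ≥ … ≥ r_m ≥ 0 (set r_{m+1} := 0), weights b_1,…,b_m > 0 and capacities c_1,…,c_m ≥ 0. Suppose that for each j ∈ {1,…,m} there is μ^j ∈ [0,∞) with p·∫_{(0,μ^j]} u dν(u) = (Σ_{k=1}^j c_k/b_k)/T'. Then for every family of Borel measurable functions x_j : (0,∞) → [0,1] (1 ≤ j ≤ m) satisfying Σ_{j=1}^m x_j(u) ≤ 1 for all u and T'·p·b_j·∫ u·x_j(u) dν(u) ≤ c_j for every j, one has T'·p·Σ_{j=1}^m r_j·∫ x_j(u) dν(u) ≤ T'·p·Σ_{j=1}^m (r_j − r_{j+1})·F(μ^j). -/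
open MeasureTheory

lemma aux_thr (ν : Measure ℝ) [IsProbabilityMeasure ν] (hsupp : ν (Set.Iic 0) = 0)
    (hmean : Integrable (fun u : ℝ => u) ν) (y : ℝ → ℝ) (hy : Measurable y)
    (h01 : ∀ u, y u ∈ Set.Icc (0:ℝ) 1) (w : ℝ) (hw : 0 ≤ w)
    (h : ∫ u, u * y u ∂ν ≤ ∫ u in Set.Ioc 0 w, u ∂ν) :
    ∫ u, y u ∂ν ≤ (ν (Set.Ioc 0 w)).toReal := by
  have hpos : ∀ᵐ u ∂ν, 0 < u := by
    rw [ae_iff]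
    simpa [Set.Iic] using hsupp
  have hbd : ∀ᵐ u ∂ν, ‖y u‖ ≤ 1 := Filter.Eventually.of_forall fun u => by
    rw [Real.norm_eq_abs, abs_of_nonneg (h01 u).1]; exact (h01 u).2
  have hyi : Integrable y ν := Integrable.of_bound hy.aestronglyMeasurable 1 hbd
  have huy : Integrable (fun u => u * y u) ν :=
    hmean.mul_bdd (c := 1) hy.aestronglyMeasurable hbd
  rcases hw.eq_or_lt with rfl | hw
  · simp only [Set.Ioc_self, Measure.restrict_empty, integral_zero_measure] at h
    have hnn : 0 ≤ᵐ[ν] fun u => u * y u := by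
      filter_upwards [hpos] with u hu
      exact mul_nonneg hu.le (h01 u).1
    have h0 : ∫ u, u * y u ∂ν = 0 := le_antisymm h (integral_nonneg_of_ae hnn)
    rw [integral_eq_zero_iff_of_nonneg_ae hnn huy] at h0
    have : ∫ u, y u ∂ν = 0 := by
      apply integral_eq_zero_of_ae
      filter_upwards [h0, hpos] with u h1 hu
      exact (mul_eq_zero.1 h1).resolve_left hu.ne'
    simp [this]
  · have hms : MeasurableSet (Set.Ioc 0 w) := measurableSet_Ioc
    have hci : Integrable (fun u : ℝ => w - u) ν := (integrable_const w).sub hmean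
    have key : ∫ u, (w * y u - u * y u) ∂ν ≤
        ∫ u, (Set.Ioc 0 w).indicator (fun u => w - u) u ∂ν := by
      apply integral_mono_ae ((hyi.const_mul w).sub huy) (hci.indicator hms)
      filter_upwards [hpos] with u hu
      have h1 := (h01 u).1
      have h2 := (h01 u).2
      by_cases huw : u ≤ w
      · rw [Set.indicator_of_mem (show u ∈ Set.Ioc 0 w from ⟨hu, huw⟩)]
        simp only [Pi.sub_apply]
        nlinarith
      · rw [Set.indicator_of_notMem (fun hh => huw hh.2)]
        simp only [Pi.sub_apply]
        nlinarith
    rw [integral_sub (hyi.const_mul w) huy, integral_const_mul, integral_indicator hms,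
      integral_sub (integrable_const w) hmean.integrableOn, setIntegral_const,
      smul_eq_mul, Measure.real] at key
    refine le_of_mul_le_mul_left ?_ hw
    linarith

lemma aux_abel (r a : ℕ → ℝ) (n : ℕ) : ∑ j ∈ Finset.Icc 1 n, r j * a j =
    ∑ j ∈ Finset.Icc 1 n, (r j - r (j + 1)) * (∑ k ∈ Finset.Icc 1 j, a k)
      + r (n + 1) * ∑ k ∈ Finset.Icc 1 n, a k := by
  induction n with
  | zero => simp
  | succ n ih =>
    rw [Finset.sum_Icc_succ_top (by omega), Finset.sum_Icc_succ_top (by omega), ih,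
      Finset.sum_Icc_succ_top (by omega)]
    ring

/-- threshold upper bound for the single-type sub-LP: any feasible family
`x_j` has value at most `T'·p·Σ_j (r_j − r_{j+1})·F(μ^j)`. -/
theorem stmt5
    (ν : Measure ℝ) [IsProbabilityMeasure ν] (hsupp : ν (Set.Iic 0) = 0)
    (F : ℝ → ℝ) (hF : ∀ w, F w = (ν (Set.Ioc 0 w)).toReal) (hFcont : Continuous F)
    (hmean : Integrable (fun u : ℝ => u) ν)
    (p T' : ℝ) (hp : 0 < p) (hp1 : p ≤ 1) (hT' : 0 < T')
    (m : ℕ) (hm : 1 ≤ m)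
    (r : ℕ → ℝ) (hrmono : ∀ j, 1 ≤ j → j < m → r (j + 1) ≤ r j)
    (hrm : 0 ≤ r m) (hrtop : r (m + 1) = 0)
    (b c : ℕ → ℝ) (hb : ∀ j ∈ Finset.Icc 1 m, 0 < b j) (hc : ∀ j ∈ Finset.Icc 1 m, 0 ≤ c j)
    (μ : ℕ → ℝ)
    (hμ : ∀ j ∈ Finset.Icc 1 m, 0 ≤ μ j ∧
      p * ∫ u in Set.Ioc 0 (μ j), u ∂ν = (∑ k ∈ Finset.Icc 1 j, c k / b k) / T')
    (x : ℕ → ℝ → ℝ) (hxmeas : ∀ j, Measurable (x j))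
    (hx01 : ∀ j u, x j u ∈ Set.Icc (0:ℝ) 1)
    (hxsum : ∀ u, ∑ j ∈ Finset.Icc 1 m, x j u ≤ 1)
    (hxcap : ∀ j ∈ Finset.Icc 1 m, T' * p * b j * ∫ u, u * x j u ∂ν ≤ c j) :
    T' * p * ∑ j ∈ Finset.Icc 1 m, r j * ∫ u, x j u ∂ν ≤
      T' * p * ∑ j ∈ Finset.Icc 1 m, (r j - r (j + 1)) * F (μ j) := by
  have hbd : ∀ j, ∀ᵐ u ∂ν, ‖x j u‖ ≤ 1 := fun j => Filter.Eventually.of_forall fun u => by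
    rw [Real.norm_eq_abs, abs_of_nonneg (hx01 j u).1]; exact (hx01 j u).2
  have hxi : ∀ j, Integrable (x j) ν := fun j =>
    Integrable.of_bound (hxmeas j).aestronglyMeasurable 1 (hbd j)
  have hux : ∀ j, Integrable (fun u => u * x j u) ν := fun j =>
    hmean.mul_bdd (c := 1) (hxmeas j).aestronglyMeasurable (hbd j)
  apply mul_le_mul_of_nonneg_left _ (mul_pos hT' hp).le
  rw [aux_abel r (fun j => ∫ u, x j u ∂ν) m, hrtop, zero_mul, add_zero]
  apply Finset.sum_le_sum
  intro j hj
  have hj' := Finset.mem_Icc.1 hj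
  have hr : 0 ≤ r j - r (j + 1) := by
    rcases hj'.2.eq_or_lt with rfl | hlt
    · rw [hrtop]; linarith
    · linarith [hrmono j hj'.1 hlt]
  apply mul_le_mul_of_nonneg_left _ hr
  rw [hF, ← integral_finsetSum _ (fun k _ => hxi k)]
  apply aux_thr ν hsupp hmean
  · exact Finset.measurable_sum _ fun k _ => hxmeas k
  · intro u
    refine ⟨Finset.sum_nonneg fun k _ => (hx01 k u).1, le_trans ?_ (hxsum u)⟩
    exact Finset.sum_le_sum_of_subset_of_nonneg
      (Finset.Icc_subset_Icc_right hj'.2) fun k _ _ => (hx01 k u).1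
  · exact (hμ j hj).1
  · simp_rw [Finset.mul_sum]
    rw [integral_finsetSum _ (fun k _ => hux k)]
    have h2 := (hμ j hj).2
    have h3 : T' * p * ∑ k ∈ Finset.Icc 1 j, ∫ u, u * x k u ∂ν ≤
        ∑ k ∈ Finset.Icc 1 j, c k / b k := by
      rw [Finset.mul_sum]
      apply Finset.sum_le_sum
      intro k hk
      have hk' : k ∈ Finset.Icc 1 m := Finset.Icc_subset_Icc_right hj'.2 hk
      rw [le_div_iff₀ (hb k hk')]
      linarith [hxcap k hk']
    rw [eq_div_iff hT'.ne'] at h2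
    refine le_of_mul_le_mul_left ?_ (mul_pos hT' hp)
    linarith
end

section
/- Let ν be a Borel probability measure on (0,∞) with continuous CDF F(w) = ν((0,w]) and finite mean. Let p ∈ (0,1], T' > 0, m ≥ 1, rewards r_1 ≥ r_2 ≥ … ≥ r_m ≥ 0 (set r_{m+1} := 0), weights b_1,…,b_m > 0 and capacities c_1,…,c_m ≥ 0. Suppose that for each j ∈ {1,…,m} there is μ^j ∈ [0,∞) with p·∫_{(0,μ^j]} u dν(u) = (Σ_{k=1}^j c_k/b_k)/T', and set μ^0 := 0. Then μ^1 ≤ μ^2 ≤ … ≤ μ^m can be chosen, and the threshold functions x̂_j := 1_{(μ^{j−1}, μ^j]} satisfy the feasibility constraints Σ_{j=1}^m x̂_j(u) ≤ 1 for all u and T'·p·b_j·∫ u·x̂_j(u) dν(u) ≤ c_j for every j, and attain the value T'·p·Σ_{j=1}^m r_j·∫ x̂_j(u) dν(u) = T'·p·Σ_{j=1}^m (r_j − r_{j+1})·F(μ^j). -/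
open MeasureTheory

/-- achievability: the thresholds `μ^j` can be chosen nondecreasing (with
`μ^0 := 0`), and the indicator functions `x̂_j = 1_{(μ^{j−1},μ^j]}` are feasible for the
single-type sub-LP and attain the value `T'·p·Σ_j (r_j − r_{j+1})·F(μ^j)`. -/
theorem stmt6
    (ν : Measure ℝ) [IsProbabilityMeasure ν] (hsupp : ν (Set.Iic 0) = 0)
    (F : ℝ → ℝ) (hF : ∀ w, F w = (ν (Set.Ioc 0 w)).toReal) (hFcont : Continuous F)
    (hmean : Integrable (fun u : ℝ => u) ν)
    (p T' : ℝ) (hp : 0 < p) (hp1 : p ≤ 1) (hT' : 0 < T')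
    (m : ℕ) (hm : 1 ≤ m)
    (r : ℕ → ℝ) (hrmono : ∀ j, 1 ≤ j → j < m → r (j + 1) ≤ r j)
    (hrm : 0 ≤ r m) (hrtop : r (m + 1) = 0)
    (b c : ℕ → ℝ) (hb : ∀ j ∈ Finset.Icc 1 m, 0 < b j) (hc : ∀ j ∈ Finset.Icc 1 m, 0 ≤ c j)
    (hex : ∀ j ∈ Finset.Icc 1 m, ∃ μj : ℝ, 0 ≤ μj ∧
      p * ∫ u in Set.Ioc 0 μj, u ∂ν = (∑ k ∈ Finset.Icc 1 j, c k / b k) / T') :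
    ∃ μ : ℕ → ℝ, μ 0 = 0 ∧
      (∀ j ∈ Finset.Icc 1 m, 0 ≤ μ j ∧
        p * ∫ u in Set.Ioc 0 (μ j), u ∂ν = (∑ k ∈ Finset.Icc 1 j, c k / b k) / T') ∧
      (∀ j k, 1 ≤ j → j ≤ k → k ≤ m → μ j ≤ μ k) ∧
      (∀ u : ℝ, ∑ j ∈ Finset.Icc 1 m, (Set.Ioc (μ (j - 1)) (μ j)).indicator (fun _ => (1:ℝ)) u ≤ 1) ∧
      (∀ j ∈ Finset.Icc 1 m,
        T' * p * b j * ∫ u in Set.Ioc (μ (j - 1)) (μ j), u ∂ν ≤ c j) ∧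
      T' * p * ∑ j ∈ Finset.Icc 1 m, r j * (ν (Set.Ioc (μ (j - 1)) (μ j))).toReal =
        T' * p * ∑ j ∈ Finset.Icc 1 m, (r j - r (j + 1)) * F (μ j) := by
  classical
  have hGmono : ∀ x y : ℝ, x ≤ y →
      ∫ u in Set.Ioc 0 x, u ∂ν ≤ ∫ u in Set.Ioc 0 y, u ∂ν := by
    intro x y hxy
    apply setIntegral_mono_set hmean.integrableOn
    · filter_upwards [ae_restrict_mem measurableSet_Ioc] with u hu
      exact hu.1.le
    · exact (Set.Ioc_subset_Ioc_right hxy).eventuallyLE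
  have hGsplit : ∀ x y : ℝ, 0 ≤ x → x ≤ y →
      ∫ u in Set.Ioc 0 y, u ∂ν = ∫ u in Set.Ioc 0 x, u ∂ν + ∫ u in Set.Ioc x y, u ∂ν := by
    intro x y hx hxy
    rw [← Set.Ioc_union_Ioc_eq_Ioc hx hxy]
    exact setIntegral_union (Set.Ioc_disjoint_Ioc_of_le le_rfl) measurableSet_Ioc
      hmean.integrableOn hmean.integrableOn
  have hFsplit : ∀ x y : ℝ, 0 ≤ x → x ≤ y →
      (ν (Set.Ioc x y)).toReal = F y - F x := by
    intro x y hx hxy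
    rw [hF, hF, ← Set.Ioc_union_Ioc_eq_Ioc hx hxy,
      measure_union (Set.Ioc_disjoint_Ioc_of_le le_rfl) measurableSet_Ioc,
      ENNReal.toReal_add (measure_ne_top _ _) (measure_ne_top _ _)]
    ring
  have hex' : ∀ j, ∃ x : ℝ, j ∈ Finset.Icc 1 m → 0 ≤ x ∧
      p * ∫ u in Set.Ioc 0 x, u ∂ν = (∑ k ∈ Finset.Icc 1 j, c k / b k) / T' := by
    intro j
    by_cases h : j ∈ Finset.Icc 1 m
    · obtain ⟨x, hx⟩ := hex j h
      exact ⟨x, fun _ => hx⟩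
    · exact ⟨0, fun h' => absurd h' h⟩
  choose g hg using hex'
  let μ : ℕ → ℝ := fun n => Nat.rec 0 (fun n a => max a (g (n + 1))) n
  have h0 : μ 0 = 0 := rfl
  have hs : ∀ n, μ (n + 1) = max (μ n) (g (n + 1)) := fun n => rfl
  have hmono : Monotone μ := monotone_nat_of_le_succ fun n => by
    rw [hs]; exact le_max_left _ _
  have hpos : ∀ n, 0 ≤ μ n := fun n => h0 ▸ hmono (Nat.zero_le n)
  clear_value μ
  have hS : ∀ n, n ≤ m →
      p * ∫ u in Set.Ioc 0 (μ n), u ∂ν = (∑ k ∈ Finset.Icc 1 n, c k / b k) / T' := by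
    intro n
    induction n with
    | zero => intro _; simp [h0]
    | succ n ih =>
      intro hn
      have ih := ih (by omega)
      have hmem : n + 1 ∈ Finset.Icc 1 m := by simp; omega
      have hgn := (hg (n + 1) hmem).2
      rw [hs]
      rcases le_total (μ n) (g (n + 1)) with h | h
      · rw [max_eq_right h, hgn]
      · rw [max_eq_left h]
        apply le_antisymm
        · rw [ih, Finset.sum_Icc_succ_top (by omega)]
          have := div_nonneg (hc _ hmem) (hb _ hmem).le
          gcongr
          linarith
        · rw [← hgn]
          exact mul_le_mul_of_nonneg_left (hGmono _ _ h) hp.le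
  refine ⟨μ, h0, ?_, fun j k _ h _ => hmono h, ?_, ?_, ?_⟩
  · intro j hj
    exact ⟨hpos j, hS j (Finset.mem_Icc.1 hj).2⟩
  · intro u
    have key : ∀ n, ∑ j ∈ Finset.Icc 1 n,
        (Set.Ioc (μ (j - 1)) (μ j)).indicator (fun _ => (1:ℝ)) u
        = (Set.Ioc 0 (μ n)).indicator (fun _ => (1:ℝ)) u := by
      intro n
      induction n with
      | zero => simp [h0]
      | succ n ih =>
        rw [Finset.sum_Icc_succ_top (by omega), ih, Nat.add_sub_cancel,
          ← Set.Ioc_union_Ioc_eq_Ioc (hpos n) (hmono (Nat.le_succ n)),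
          Set.indicator_union_of_disjoint (Set.Ioc_disjoint_Ioc_of_le le_rfl)]
    rw [key]
    exact Set.indicator_le' (fun _ _ => le_rfl) (fun _ _ => zero_le_one) u
  · intro j hj
    have hbj := hb j hj
    obtain ⟨h1, h2⟩ := Finset.mem_Icc.1 hj
    obtain ⟨n, rfl⟩ : ∃ n, j = n + 1 := ⟨j - 1, by omega⟩
    rw [Nat.add_sub_cancel]
    have e1 := hS (n + 1) h2
    have e0 := hS n (by omega)
    rw [hGsplit _ _ (hpos n) (hmono (Nat.le_succ n)), mul_add, e0,
      Finset.sum_Icc_succ_top (by omega), add_div] at e1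
    have e2 := add_left_cancel e1
    apply le_of_eq
    calc _ = T' * b (n + 1) * (p * ∫ u in Set.Ioc (μ n) (μ (n + 1)), u ∂ν) := by ring
      _ = c (n + 1) := by
        rw [e2]; field_simp
  · congr 1
    have key : ∀ n, ∑ j ∈ Finset.Icc 1 n, r j * (ν (Set.Ioc (μ (j - 1)) (μ j))).toReal =
        ∑ j ∈ Finset.Icc 1 n, (r j - r (j + 1)) * F (μ j) + r (n + 1) * F (μ n) := by
      intro n
      induction n with
      | zero => simp [h0, hF]
      | succ n ih =>
        rw [Finset.sum_Icc_succ_top (by omega), ih, Finset.sum_Icc_succ_top (by omega),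
          Nat.add_sub_cancel, hFsplit _ _ (hpos n) (hmono (Nat.le_succ n))]
        ring
    rw [key, hrtop]
    ring
end

section
/- Let ν be a Borel probability measure on (0,∞) with continuous CDF F(w) = ν((0,w]), and suppose there exist ω̄ > 0, λ ∈ (0,1) and constants 1 < γ₁ < γ₂ such that γ₁·F(λw) ≤ F(w) ≤ γ₂·F(λw) and F(w) > 0 for all w ∈ (0,ω̄). Then there exists a constant M > 1 such that for all w₁, w₂ with 0 < w₁ < w₂ < ω̄: w₂·(F(w₂) − F(w₁)) ≤ M·∫_{(w₁,w₂]} u dν(u). -/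
open MeasureTheory

/-- there is a constant `M > 1` with
`w₂·(F(w₂) − F(w₁)) ≤ M·∫_{(w₁,w₂]} u dν(u)` for all `0 < w₁ < w₂ < ω̄`. -/
theorem stmt7
    (ν : Measure ℝ) [IsProbabilityMeasure ν] (hsupp : ν (Set.Iic 0) = 0)
    (F : ℝ → ℝ) (hF : ∀ w, F w = (ν (Set.Ioc 0 w)).toReal) (hFcont : Continuous F)
    (ob lam γ₁ γ₂ : ℝ) (hω : 0 < ob) (hlam : lam ∈ Set.Ioo (0:ℝ) 1)
    (hγ₁ : 1 < γ₁) (hγ₁₂ : γ₁ < γ₂)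
    (hreg : ∀ w ∈ Set.Ioo 0 ob, γ₁ * F (lam * w) ≤ F w ∧ F w ≤ γ₂ * F (lam * w))
    (hpos : ∀ w ∈ Set.Ioo 0 ob, 0 < F w) :
    ∃ M : ℝ, 1 < M ∧ ∀ w₁ w₂ : ℝ, 0 < w₁ → w₁ < w₂ → w₂ < ob →
      w₂ * (F w₂ - F w₁) ≤ M * ∫ u in Set.Ioc w₁ w₂, u ∂ν := by
  obtain ⟨hl0, hl1⟩ := hlam
  have hint : ∀ a b : ℝ, IntegrableOn (fun u : ℝ => u) (Set.Ioc a b) ν := fun a b =>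
    (continuous_id.integrableOn_Icc (a := a) (b := b)).mono_set Set.Ioc_subset_Icc_self
  have hdiff : ∀ a b : ℝ, 0 ≤ a → a ≤ b → F b - F a = ν.real (Set.Ioc a b) := by
    intro a b ha hab
    have h : ν.real (Set.Ioc 0 b) = ν.real (Set.Ioc 0 a) + ν.real (Set.Ioc a b) := by
      rw [← Set.Ioc_union_Ioc_eq_Ioc ha hab]
      exact measureReal_union (Set.Ioc_disjoint_Ioc_of_le le_rfl) measurableSet_Ioc
    have h1 : F b = ν.real (Set.Ioc 0 b) := hF b
    have h2 : F a = ν.real (Set.Ioc 0 a) := hF a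
    linarith
  have key : ∀ a b : ℝ, 0 ≤ a → a ≤ b → a * (F b - F a) ≤ ∫ u in Set.Ioc a b, u ∂ν := by
    intro a b ha hab
    rw [hdiff a b ha hab]
    exact setIntegral_ge_of_const_le_real measurableSet_Ioc (measure_ne_top _ _)
      (fun x hx => hx.1.le) (hint a b)
  have hF0 : ∀ w, 0 ≤ F w := fun w => by rw [hF]; exact ENNReal.toReal_nonneg
  have hg : 0 < γ₁ - 1 := by linarith
  have hd : 0 < lam * (γ₁ - 1) := mul_pos hl0 hg
  refine ⟨γ₁ / (lam * (γ₁ - 1)), ?_, ?_⟩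
  · rw [lt_div_iff₀ hd]; nlinarith
  intro w₁ w₂ h1 h12 h2
  have hw2 : 0 < w₂ := h1.trans h12
  have hD : 0 ≤ F w₂ - F w₁ := by
    rw [hdiff _ _ h1.le h12.le]; exact measureReal_nonneg
  rw [div_mul_eq_mul_div, le_div_iff₀ hd]
  rcases le_or_gt (lam * w₂) w₁ with h | h
  · have hk := key w₁ w₂ h1.le h12.le
    have hk2 : lam * w₂ * (F w₂ - F w₁) ≤ ∫ u in Set.Ioc w₁ w₂, u ∂ν :=
      (mul_le_mul_of_nonneg_right h hD).trans hk
    have h0 : 0 ≤ lam * w₂ * (F w₂ - F w₁) := by positivity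
    nlinarith
  · have hlw : lam * w₂ ≤ w₂ := by nlinarith
    have hk := key (lam * w₂) w₂ (by positivity) hlw
    have hmono : ∫ u in Set.Ioc (lam * w₂) w₂, u ∂ν ≤ ∫ u in Set.Ioc w₁ w₂, u ∂ν := by
      apply setIntegral_mono_set (hint _ _)
      · filter_upwards [ae_restrict_mem measurableSet_Ioc] with x hx
        exact (h1.trans hx.1).le
      · exact (Set.Ioc_subset_Ioc_left h.le).eventuallyLE
    have hr := (hreg w₂ ⟨hw2, h2⟩).1
    have hF1 := hF0 w₁
    have hp : 0 < lam * w₂ := by positivity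
    have e1 : (γ₁ - 1) * (F w₂ - F w₁) ≤ γ₁ * (F w₂ - F (lam * w₂)) := by nlinarith
    have e2 := mul_le_mul_of_nonneg_left e1 hp.le
    have e3 := mul_le_mul_of_nonneg_left (hk.trans hmono) (by linarith : (0:ℝ) ≤ γ₁)
    linarith
end

section
/- Let ν be a Borel probability measure on (0,∞) with CDF F(w) = ν((0,w]). Suppose there exist ω̄ > 0, λ ∈ (0,1) and γ₁ > 1 such that γ₁·F(λw) ≤ F(w) and F(w) > 0 for all w ∈ (0,ω̄). Then for every w ∈ (0,ω̄): w·F(w) ≤ (γ₁/(λ·(γ₁ − 1)))·∫_{(0,w]} u dν(u). -/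
open MeasureTheory

/-- explicit upper bound on `w·F(w)` in terms of `∫_{(0,w]} u dν(u)`
for distributions whose CDF is bounded below by `γ₁·F(λw)` near zero. -/
theorem stmt8
    (ν : Measure ℝ) [IsProbabilityMeasure ν] (hsupp : ν (Set.Iic 0) = 0)
    (F : ℝ → ℝ) (hF : ∀ w, F w = (ν (Set.Ioc 0 w)).toReal)
    (ob lam γ₁ : ℝ) (hω : 0 < ob) (hlam : lam ∈ Set.Ioo (0:ℝ) 1) (hγ₁ : 1 < γ₁)
    (hreg : ∀ w ∈ Set.Ioo 0 ob, γ₁ * F (lam * w) ≤ F w)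
    (hpos : ∀ w ∈ Set.Ioo 0 ob, 0 < F w) :
    ∀ w ∈ Set.Ioo 0 ob,
      w * F w ≤ (γ₁ / (lam * (γ₁ - 1))) * ∫ u in Set.Ioc 0 w, u ∂ν := by
  intro w hw
  obtain ⟨hw0, hwo⟩ := hw
  obtain ⟨hl0, hl1⟩ := hlam
  have hlw : 0 < lam * w := mul_pos hl0 hw0
  have hlw' : lam * w ≤ w := by nlinarith
  have hsplit : F w = F (lam * w) + ν.real (Set.Ioc (lam * w) w) := by
    rw [hF, hF, ← Set.Ioc_union_Ioc_eq_Ioc hlw.le hlw']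
    exact measureReal_union (μ := ν) (Set.Ioc_disjoint_Ioc_of_le le_rfl) measurableSet_Ioc
  have hint : IntegrableOn (fun u : ℝ => u) (Set.Ioc 0 w) ν :=
    (continuous_id.integrableOn_Icc (a := 0) (b := w)).mono_set Set.Ioc_subset_Icc_self
  have hsub : Set.Ioc (lam * w) w ⊆ Set.Ioc 0 w := Set.Ioc_subset_Ioc_left hlw.le
  have h1 : ∫ u in Set.Ioc (lam * w) w, u ∂ν ≤ ∫ u in Set.Ioc 0 w, u ∂ν := by
    apply setIntegral_mono_set hint
    · filter_upwards [ae_restrict_mem measurableSet_Ioc] with u hu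
      exact hu.1.le
    · exact hsub.eventuallyLE
  have h2 : (lam * w) * ν.real (Set.Ioc (lam * w) w) ≤ ∫ u in Set.Ioc (lam * w) w, u ∂ν := by
    have := setIntegral_mono_on (μ := ν) (s := Set.Ioc (lam * w) w)
      (f := fun _ => lam * w) (g := fun u => u) (integrableOn_const (by simp))
      (hint.mono_set hsub) measurableSet_Ioc (fun u hu => hu.1.le)
    rw [setIntegral_const, smul_eq_mul] at this
    linarith
  have h3 := hreg w ⟨hw0, hwo⟩
  have hd : 0 < lam * (γ₁ - 1) := mul_pos hl0 (by linarith)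
  rw [div_mul_eq_mul_div, le_div_iff₀ hd]
  have h4 : (lam * w) * (F w - F (lam * w)) ≤ ∫ u in Set.Ioc 0 w, u ∂ν := by
    rw [hsplit, add_sub_cancel_left]
    exact h2.trans h1
  have h5 := mul_le_mul_of_nonneg_left h4 (by linarith : (0:ℝ) ≤ γ₁)
  have h6 := mul_le_mul_of_nonneg_left h3 hlw.le
  nlinarith
end

section
/- Let ν be a Borel probability measure on (0,∞) with CDF F(w) = ν((0,w]). Suppose there exist ω̄ > 0, λ ∈ (0,1) and constants 1 < γ₁ < γ₂ such that γ₁·F(λw) ≤ F(w) ≤ γ₂·F(λw) and F(w) > 0 for all w ∈ (0,ω̄). Then for every w ∈ (0,ω̄): w·F(w) ≥ (γ₂·(γ₁ − λ)/(γ₁·(γ₂ − 1)))·∫_{(0,w]} u dν(u). -/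
open MeasureTheory

/-- explicit lower bound on `w·F(w)` in terms of `∫_{(0,w]} u dν(u)`
for distributions whose CDF is controlled from both sides by its value at `λ·w` near zero. -/
theorem stmt9
    (ν : Measure ℝ) [IsProbabilityMeasure ν] (hsupp : ν (Set.Iic 0) = 0)
    (F : ℝ → ℝ) (hF : ∀ w, F w = (ν (Set.Ioc 0 w)).toReal)
    (ob lam γ₁ γ₂ : ℝ) (hω : 0 < ob) (hlam : lam ∈ Set.Ioo (0:ℝ) 1)
    (hγ₁ : 1 < γ₁) (hγ₁₂ : γ₁ < γ₂)
    (hreg : ∀ w ∈ Set.Ioo 0 ob, γ₁ * F (lam * w) ≤ F w ∧ F w ≤ γ₂ * F (lam * w))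
    (hpos : ∀ w ∈ Set.Ioo 0 ob, 0 < F w) :
    ∀ w ∈ Set.Ioo 0 ob,
      (γ₂ * (γ₁ - lam) / (γ₁ * (γ₂ - 1))) * ∫ u in Set.Ioc 0 w, u ∂ν ≤ w * F w := by
  intro w₀ hw₀
  obtain ⟨hl0, hl1⟩ := hlam
  have hg1 : 0 < γ₁ := by linarith
  have hg2 : 0 < γ₂ := by linarith
  have hint : ∀ a b : ℝ, IntegrableOn (fun u : ℝ => u) (Set.Ioc a b) ν := fun a b =>
    (continuous_id.integrableOn_Icc (μ := ν) (a := a) (b := b)).mono_set Set.Ioc_subset_Icc_self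
  have hbd : ∀ a b : ℝ, ∫ u in Set.Ioc a b, u ∂ν ≤ b * (ν (Set.Ioc a b)).toReal := by
    intro a b
    have h : ∫ u in Set.Ioc a b, u ∂ν ≤ ∫ u in Set.Ioc a b, b ∂ν :=
      setIntegral_mono_on (hint a b) (integrable_const b) measurableSet_Ioc (fun x hx => hx.2)
    rw [setIntegral_const, smul_eq_mul, mul_comm] at h
    exact h
  have hstep : ∀ w ∈ Set.Ioo 0 ob, ∫ u in Set.Ioc 0 w, u ∂ν ≤
      (∫ u in Set.Ioc 0 (lam * w), u ∂ν) + w * (F w - F (lam * w)) := by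
    intro w hw
    have h1 : 0 ≤ lam * w := (mul_pos hl0 hw.1).le
    have h2 : lam * w ≤ w := by nlinarith [hw.1]
    have hd : Disjoint (Set.Ioc 0 (lam * w)) (Set.Ioc (lam * w) w) :=
      Set.Ioc_disjoint_Ioc_of_le le_rfl
    have hu := Set.Ioc_union_Ioc_eq_Ioc h1 h2
    have hI : ∫ u in Set.Ioc 0 w, u ∂ν = (∫ u in Set.Ioc 0 (lam * w), u ∂ν) +
        ∫ u in Set.Ioc (lam * w) w, u ∂ν := by
      rw [← hu]
      exact setIntegral_union hd measurableSet_Ioc (hint _ _) (hint _ _)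
    have hM : F w = F (lam * w) + (ν (Set.Ioc (lam * w) w)).toReal := by
      rw [hF, hF, ← hu, measure_union hd measurableSet_Ioc,
        ENNReal.toReal_add (measure_ne_top _ _) (measure_ne_top _ _)]
    rw [hI, hM]
    have := hbd (lam * w) w
    linarith
  obtain ⟨r, hr⟩ : ∃ r, r = lam / γ₁ := ⟨_, rfl⟩
  have hr0 : 0 < r := by rw [hr]; positivity
  have hr1 : r < 1 := by rw [hr, div_lt_one hg1]; linarith
  obtain ⟨K, hK⟩ : ∃ K, K = γ₁ * (γ₂ - 1) / (γ₂ * (γ₁ - lam)) := ⟨_, rfl⟩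
  have hgl : 0 < γ₁ - lam := by linarith
  have hg21 : 0 < γ₂ - 1 := by linarith
  have hK0 : 0 < K := by rw [hK]; positivity
  have hKr : K * r + (1 - 1 / γ₂) = K := by
    rw [hK, hr]
    field_simp
    ring
  have key : ∀ n : ℕ, ∀ w ∈ Set.Ioo 0 ob,
      ∫ u in Set.Ioc 0 w, u ∂ν ≤ (K + r ^ n) * (w * F w) := by
    intro n
    induction n with
    | zero =>
      intro w hw
      have h1 := hbd 0 w
      rw [← hF] at h1
      have h2 := mul_pos hw.1 (hpos w hw)
      have h3 := mul_pos hK0 h2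
      rw [pow_zero]
      linarith
    | succ n ih =>
      intro w hw
      have hw' : lam * w ∈ Set.Ioo 0 ob := ⟨mul_pos hl0 hw.1, by nlinarith [hw.1, hw.2]⟩
      have h1 := ih _ hw'
      have h2 := hstep w hw
      obtain ⟨h3, h4⟩ := hreg w hw
      have h5 : lam * w * F (lam * w) ≤ r * (w * F w) := by
        have : F (lam * w) ≤ F w / γ₁ := by rw [le_div_iff₀ hg1]; linarith
        calc lam * w * F (lam * w) ≤ lam * w * (F w / γ₁) :=
              mul_le_mul_of_nonneg_left this hw'.1.le
          _ = r * (w * F w) := by rw [hr]; ring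
      have h6 : w * (F w - F (lam * w)) ≤ (1 - 1 / γ₂) * (w * F w) := by
        have : F w / γ₂ ≤ F (lam * w) := by rw [div_le_iff₀ hg2]; linarith
        calc w * (F w - F (lam * w)) ≤ w * (F w - F w / γ₂) :=
              mul_le_mul_of_nonneg_left (by linarith) hw.1.le
          _ = _ := by ring
      have h7 : (K + r ^ n) * (lam * w * F (lam * w)) ≤ (K + r ^ n) * (r * (w * F w)) :=
        mul_le_mul_of_nonneg_left h5 (by positivity)
      have h8 : (K + r ^ (n + 1)) * (w * F w) =
          (K + r ^ n) * (r * (w * F w)) + (1 - 1 / γ₂) * (w * F w) := by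
        nth_rewrite 1 [← hKr]
        ring
      linarith
  have hlim : Filter.Tendsto (fun n : ℕ => (K + r ^ n) * (w₀ * F w₀)) Filter.atTop
      (nhds ((K + 0) * (w₀ * F w₀))) :=
    ((tendsto_pow_atTop_nhds_zero_of_lt_one hr0.le hr1).const_add K).mul_const _
  have hfin := ge_of_tendsto' hlim (fun n => key n w₀ hw₀)
  rw [add_zero] at hfin
  have hC : γ₂ * (γ₁ - lam) / (γ₁ * (γ₂ - 1)) = K⁻¹ := by rw [hK, inv_div]
  rw [hC, inv_mul_le_iff₀ hK0]
  exact hfin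
end

section
/- Let ν be a Borel probability measure on (0,∞) with a continuous density f such that f(w) > 0 for w ∈ (0,ω̄) and w ↦ w³·f(w) is nondecreasing on (0,ω̄), for some ω̄ > 0. Let p ∈ (0,1], T' > 0, b_1,…,b_m > 0, and fix j ∈ {1,…,m}. For c̃ ∈ (0,∞)^m, let μ^j(c̃) denote the solution of p·∫_0^{μ^j(c̃)} u·f(u) du = (Σ_{k=1}^j c̃_k/b_k)/T' whenever this solution lies in (0,ω̄). Then for each k ∈ {1,…,j}, the map c̃_k ↦ 1/μ^j(c̃) (all other coordinates of c̃ held fixed) is convex on every interval of values of c̃_k on which μ^j(c̃) ∈ (0,ω̄). -/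
open MeasureTheory

lemma aux_integral (K z x : ℝ) (hz : 0 < z) (hx : 0 < x) :
    IntervalIntegrable (fun w : ℝ => K / w ^ 2) volume z x ∧
    ∫ w in z..x, K / w ^ 2 = K * (1 / z - 1 / x) := by
  have hpos : ∀ w ∈ Set.uIcc z x, w ≠ 0 := by
    intro w hw
    have := (Set.mem_uIcc.1 hw)
    rcases this with h | h
    · exact (hz.trans_le h.1).ne'
    · exact (hx.trans_le h.1).ne'
  have hi : IntervalIntegrable (fun w : ℝ => K / w ^ 2) volume z x := by
    apply ContinuousOn.intervalIntegrable
    exact continuousOn_const.div (by fun_prop) (fun w hw => pow_ne_zero 2 (hpos w hw))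
  refine ⟨hi, ?_⟩
  rw [intervalIntegral.integral_eq_sub_of_hasDerivAt (f := fun w => -(K * w⁻¹)) _ hi]
  · simp only [one_div]; ring
  · intro w hw
    have h := ((hasDerivAt_inv (hpos w hw)).const_mul K).neg
    have e : K / w ^ 2 = -(K * -(w ^ 2)⁻¹) := by ring
    rw [e]
    exact h

lemma aux_tangent (ob : ℝ) (f : ℝ → ℝ) (hfc : ContinuousOn f (Set.Ioi 0))
    (hfmono : MonotoneOn (fun w => w ^ 3 * f w) (Set.Ioo 0 ob))
    (z x : ℝ) (hz : z ∈ Set.Ioo 0 ob) (hx : x ∈ Set.Ioo 0 ob) :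
    z ^ 3 * f z * (1 / z - 1 / x) ≤ ∫ w in z..x, w * f w := by
  have key : ∀ w : ℝ, 0 < w → w * f w = w ^ 3 * f w / w ^ 2 := by
    intro w hw; field_simp
  have hsub : ∀ w ∈ Set.uIcc z x, w ∈ Set.Ioo 0 ob := by
    intro w hw
    exact Set.OrdConnected.uIcc_subset Set.ordConnected_Ioo hz hx hw
  have hgi : IntervalIntegrable (fun w => w * f w) volume z x := by
    apply ContinuousOn.intervalIntegrable
    exact continuousOn_id.mul (hfc.mono fun w hw => (hsub w hw).1)
  obtain ⟨hi, he⟩ := aux_integral (z ^ 3 * f z) z x hz.1 hx.1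
  rw [← he]
  rcases le_total z x with h | h
  · apply intervalIntegral.integral_mono_on h hi hgi
    intro w hw
    have hw' := hsub w (Set.Icc_subset_uIcc hw)
    rw [key w hw'.1]
    exact div_le_div_of_nonneg_right (hfmono hz hw' hw.1) (by positivity)
  · rw [intervalIntegral.integral_symm x z, intervalIntegral.integral_symm x z]
    apply neg_le_neg
    apply intervalIntegral.integral_mono_on h hgi.symm hi.symm
    intro w hw
    have hw' := hsub w (Set.Icc_subset_uIcc' hw)
    rw [key w hw'.1]
    exact div_le_div_of_nonneg_right (hfmono hw' hz hw.2) (by positivity)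

/-- convexity of the reciprocal of the LP threshold `μ^j(c̃)` in each
capacity coordinate `c̃_k`, `k ≤ j`, on intervals where the threshold lies in `(0,ω̄)`. -/
theorem stmt10
    (ob : ℝ) (hω : 0 < ob)
    (ν : Measure ℝ) [IsProbabilityMeasure ν]
    (f : ℝ → ℝ) (hfc : ContinuousOn f (Set.Ioi 0))
    (hν : ν = (MeasureTheory.volume.restrict (Set.Ioi 0)).withDensity
      (fun w => ENNReal.ofReal (f w)))
    (hfpos : ∀ w ∈ Set.Ioo 0 ob, 0 < f w)
    (hfmono : MonotoneOn (fun w => w ^ 3 * f w) (Set.Ioo 0 ob))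
    (p T' : ℝ) (hp : 0 < p) (hp1 : p ≤ 1) (hT' : 0 < T')
    (m : ℕ) (hm : 1 ≤ m)
    (b : ℕ → ℝ) (hb : ∀ l ∈ Finset.Icc 1 m, 0 < b l)
    (j : ℕ) (hj : j ∈ Finset.Icc 1 m)
    (μ : (ℕ → ℝ) → ℝ)
    (k : ℕ) (hk : k ∈ Finset.Icc 1 j)
    (c : ℕ → ℝ) (hcpos : ∀ l ∈ Finset.Icc 1 m, 0 < c l)
    (s : Set ℝ) (hs : s.OrdConnected) (hspos : s ⊆ Set.Ioi 0)
    (hsol : ∀ v ∈ s, μ (Function.update c k v) ∈ Set.Ioo 0 ob ∧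
      p * ∫ w in (0:ℝ)..(μ (Function.update c k v)), w * f w =
        (∑ l ∈ Finset.Icc 1 j, Function.update c k v l / b l) / T') :
    ConvexOn ℝ s (fun v => 1 / μ (Function.update c k v)) := by
  have hconv : Convex ℝ s := hs.convex
  refine ⟨hconv, ?_⟩
  intro v₁ h₁ v₂ h₂ α β hα hβ hαβ
  have h₃ := hconv h₁ h₂ hα hβ hαβ
  simp only [smul_eq_mul] at h₃ ⊢
  have hjm := Finset.mem_Icc.1 hj
  have hint : ∀ v ∈ s, IntervalIntegrable (fun w => w * f w) volume 0
      (μ (Function.update c k v)) := by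
    intro v hv
    by_contra hcon
    have h := (hsol v hv).2
    rw [intervalIntegral.integral_undef hcon, mul_zero] at h
    have : 0 < (∑ l ∈ Finset.Icc 1 j, Function.update c k v l / b l) / T' := by
      apply div_pos _ hT'
      apply Finset.sum_pos _ ⟨k, hk⟩
      intro l hl
      have hlm : l ∈ Finset.Icc 1 m := by
        rw [Finset.mem_Icc] at hl ⊢; omega
      apply div_pos _ (hb l hlm)
      by_cases hlk : l = k
      · subst hlk; simpa using hspos hv
      · simpa [Function.update_of_ne hlk] using hcpos l hlm
    linarith
  have haff : (∑ l ∈ Finset.Icc 1 j, Function.update c k (α * v₁ + β * v₂) l / b l) / T'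
      = α * ((∑ l ∈ Finset.Icc 1 j, Function.update c k v₁ l / b l) / T')
        + β * ((∑ l ∈ Finset.Icc 1 j, Function.update c k v₂ l / b l) / T') := by
    rw [← mul_div_assoc, ← mul_div_assoc, ← add_div, Finset.mul_sum, Finset.mul_sum,
      ← Finset.sum_add_distrib]
    congr 1
    apply Finset.sum_congr rfl
    intro l _
    by_cases hlk : l = k
    · subst hlk; simp only [Function.update_self]; ring
    · simp only [Function.update_of_ne hlk]
      rw [← add_mul, hαβ, one_mul]
  rw [← (hsol _ h₁).2, ← (hsol _ h₂).2, ← (hsol _ h₃).2] at haff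
  have i₁ := hint _ h₁
  have i₂ := hint _ h₂
  have i₃ := hint _ h₃
  have m₁ := (hsol _ h₁).1
  have m₂ := (hsol _ h₂).1
  have m₃ := (hsol _ h₃).1
  generalize μ (Function.update c k v₁) = x at *
  generalize μ (Function.update c k v₂) = y at *
  generalize μ (Function.update c k (α * v₁ + β * v₂)) = z at *
  have t₁ := aux_tangent ob f hfc hfmono z x m₃ m₁
  have t₂ := aux_tangent ob f hfc hfmono z y m₃ m₂
  rw [← intervalIntegral.integral_interval_sub_left i₁ i₃] at t₁
  rw [← intervalIntegral.integral_interval_sub_left i₂ i₃] at t₂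
  have haff' : (∫ w in (0:ℝ)..z, w * f w) =
      α * (∫ w in (0:ℝ)..x, w * f w) + β * (∫ w in (0:ℝ)..y, w * f w) := by
    apply mul_left_cancel₀ hp.ne'
    rw [haff]; ring
  have hK : 0 < z ^ 3 * f z := mul_pos (pow_pos m₃.1 3) (hfpos z m₃)
  have e₁ := mul_le_mul_of_nonneg_left t₁ hα
  have e₂ := mul_le_mul_of_nonneg_left t₂ hβ
  generalize z ^ 3 * f z = K at *
  have hβ' : β = 1 - α := by linarith
  subst hβ'
  have : K * (1 / z - (α * (1 / x) + (1 - α) * (1 / y))) ≤ 0 := by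
    linarith
  have := nonpos_of_mul_nonpos_right this hK
  linarith
end

section
/- Let ν be a Borel probability measure on (0,∞) with CDF F and a continuous density f such that f(w) > 0 for w ∈ (0,ω̄) and w ↦ w³·f(w) is nondecreasing on (0,ω̄), and suppose there exist λ ∈ (0,1) and 1 < γ₁ < γ₂ with γ₁·F(λw) ≤ F(w) ≤ γ₂·F(λw) and F(w) > 0 for all w ∈ (0,ω̄). Let M > 1 satisfy w₂·(F(w₂) − F(w₁)) ≤ M·∫_{(w₁,w₂]} u dν(u) for all 0 < w₁ < w₂ < ω̄. Let p ∈ (0,1], T' > 0, b_1,…,b_m > 0, fix j ∈ {1,…,m} and k ≤ j, and for c̃ ∈ (0,∞)^m let μ^j(c̃) solve p·∫_0^{μ^j(c̃)} u·f(u) du = (Σ_{l=1}^j c̃_l/b_l)/T'. Fix c̃ with μ^j(c̃ − b_k·v·e_k) ∈ [0,ω̄) for all v ∈ [0, c̃_k/b_k] and μ^j(c̃) ∈ (0,ω̄), where e_k is the k-th standard basis vector and μ^j := 0 when the defining right-hand side is 0. Then for every u ∈ [0, c̃_k/b_k]: F(μ^j(c̃)) − F(μ^j(c̃ − b_k·u·e_k))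 ≤ ((M−1)·u²)/((c̃_k/b_k)·p·T'·μ^j(c̃)) + u/(p·T'·μ^j(c̃)). -/
open MeasureTheory

lemma aux_kernel (ob : ℝ) (f : ℝ → ℝ) (hfc : ContinuousOn f (Set.Ioi 0))
    (hfmono : MonotoneOn (fun w => w ^ 3 * f w) (Set.Ioo 0 ob))
    (w W : ℝ) (hw : 0 < w) (hwW : w < W) (hW : W < ob) :
    ∫ x in w..W, f x * (2 * w - x - w * x / W) ≤ 0 := by
  have hW0 : 0 < W := hw.trans hwW
  have hsub : Set.uIcc w W ⊆ Set.Ioi 0 := by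
    rw [Set.uIcc_of_le hwW.le]; intro x hx; exact hw.trans_le hx.1
  set x0 := 2 * w * W / (W + w) with hx0
  have hx0w : w ≤ x0 := by
    rw [hx0, le_div_iff₀ (by positivity)]; nlinarith
  have hx0W : x0 ≤ W := by
    rw [hx0, div_le_iff₀ (by positivity)]; nlinarith
  have hx0mem : x0 ∈ Set.Ioo 0 ob := ⟨by linarith, by linarith⟩
  set g0 := x0 ^ 3 * f x0 with hg0
  have hcr : ContinuousOn (fun x : ℝ => g0 * (2 * w / x ^ 3 - (1 + w / W) / x ^ 2))
      (Set.uIcc w W) := by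
    apply ContinuousOn.mul continuousOn_const
    apply ContinuousOn.sub
    · apply ContinuousOn.div continuousOn_const (by fun_prop)
      intro x hx; have : 0 < x := hsub hx
      positivity
    · apply ContinuousOn.div continuousOn_const (by fun_prop)
      intro x hx; have : 0 < x := hsub hx
      positivity
  have hcl : ContinuousOn (fun x : ℝ => f x * (2 * w - x - w * x / W)) (Set.uIcc w W) :=
    (hfc.mono hsub).mul (by fun_prop)
  have hle : ∫ x in w..W, f x * (2 * w - x - w * x / W) ≤
      ∫ x in w..W, g0 * (2 * w / x ^ 3 - (1 + w / W) / x ^ 2) := by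
    apply intervalIntegral.integral_mono_on hwW.le hcl.intervalIntegrable hcr.intervalIntegrable
    intro x hx
    have hx0' : 0 < x := hw.trans_le hx.1
    have hxmem : x ∈ Set.Ioo 0 ob := ⟨hx0', by linarith [hx.2]⟩
    have e1 : f x * (2 * w - x - w * x / W) =
        (x ^ 3 * f x) * ((W + w) / (W * x ^ 3) * (x0 - x)) := by
      rw [hx0]; field_simp; ring
    have e2 : g0 * (2 * w / x ^ 3 - (1 + w / W) / x ^ 2) =
        g0 * ((W + w) / (W * x ^ 3) * (x0 - x)) := by
      rw [hx0]; field_simp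
    rw [e1, e2]
    have hpos : 0 < (W + w) / (W * x ^ 3) := by positivity
    rcases le_total x x0 with h | h
    · have := hfmono hxmem hx0mem h
      exact mul_le_mul_of_nonneg_right this (mul_nonneg hpos.le (by linarith))
    · have := hfmono hx0mem hxmem h
      exact mul_le_mul_of_nonpos_right this (mul_nonpos_of_nonneg_of_nonpos hpos.le (by linarith))
  refine hle.trans (le_of_eq ?_)
  have := intervalIntegral.integral_eq_sub_of_hasDerivAt
    (f := fun x : ℝ => g0 * (-w / x ^ 2 + (1 + w / W) / x))
    (f' := fun x : ℝ => g0 * (2 * w / x ^ 3 - (1 + w / W) / x ^ 2)) (a := w) (b := W)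
    (by
      intro x hx
      have hx' : 0 < x := hsub hx
      have h1 : HasDerivAt (fun x : ℝ => -w / x ^ 2) _ x :=
        (hasDerivAt_const x (-w)).div (hasDerivAt_pow 2 x) (by positivity)
      have h2 : HasDerivAt (fun x : ℝ => (1 + w / W) / x) _ x :=
        (hasDerivAt_const x (1 + w / W)).div (hasDerivAt_id x) hx'.ne'
      refine ((h1.add h2).const_mul g0).congr_deriv ?_
      field_simp
      ring) hcr.intervalIntegrable
  rw [this]
  field_simp
  ring

lemma aux_ratio (ob : ℝ) (f : ℝ → ℝ) (hfc : ContinuousOn f (Set.Ioi 0))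
    (hfpos : ∀ w ∈ Set.Ioo 0 ob, 0 < f w)
    (hfmono : MonotoneOn (fun w => w ^ 3 * f w) (Set.Ioo 0 ob))
    (w' w W : ℝ) (hw' : 0 < w') (hw'w : w' ≤ w) (hwW : w < W) (hW : W < ob) :
    (∫ x in w..W, f x * (1 - x / W)) * (∫ x in w'..W, x * f x) ^ 2 ≤
    (∫ x in w'..W, f x * (1 - x / W)) * (∫ x in w..W, x * f x) ^ 2 := by
  have hW0 : 0 < W := by linarith
  have hc1 : ContinuousOn (fun x => f x * (1 - x / W)) (Set.Ioi 0) := hfc.mul (by fun_prop)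
  have hc2 : ContinuousOn (fun x => x * f x) (Set.Ioi 0) := continuousOn_id.mul hfc
  have hsub : ∀ y, 0 < y → Set.uIcc y W ⊆ Set.Ioi 0 := by
    intro y hy x hx
    exact lt_of_lt_of_le (lt_min hy hW0) hx.1
  have hder : ∀ g : ℝ → ℝ, ContinuousOn g (Set.Ioi 0) → ∀ y, 0 < y →
      HasDerivAt (fun y => ∫ x in y..W, g x) (-g y) y := by
    intro g hg y hy
    apply intervalIntegral.integral_hasDerivAt_left
    · exact (hg.mono (hsub y hy)).intervalIntegrable
    · exact hg.stronglyMeasurableAtFilter isOpen_Ioi y hy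
    · exact hg.continuousAt (Ioi_mem_nhds hy)
  have hApos : ∀ y, 0 < y → y < W → 0 < ∫ x in y..W, x * f x := by
    intro y hy hyW
    apply intervalIntegral.intervalIntegral_pos_of_pos_on
      ((hc2.mono (hsub y hy)).intervalIntegrable) _ hyW
    intro x hx
    exact mul_pos (hy.trans hx.1) (hfpos x ⟨hy.trans hx.1, hx.2.trans hW⟩)
  have hder' : ∀ y, 0 < y → y < W → HasDerivAt
      (fun y => (∫ x in y..W, f x * (1 - x / W)) / (∫ x in y..W, x * f x) ^ 2) _ y :=
    fun y hy hyW => (hder _ hc1 y hy).div ((hder _ hc2 y hy).pow 2)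
      (pow_ne_zero 2 (hApos y hy hyW).ne')
  have hanti : AntitoneOn
      (fun y => (∫ x in y..W, f x * (1 - x / W)) / (∫ x in y..W, x * f x) ^ 2)
      (Set.Icc w' w) := by
    apply antitoneOn_of_deriv_nonpos (convex_Icc _ _)
    · intro y hy
      exact (hder' y (hw'.trans_le hy.1) (hy.2.trans_lt hwW)).continuousAt.continuousWithinAt
    · intro y hy
      rw [interior_Icc] at hy
      exact (hder' y (hw'.trans hy.1)
        (hy.2.trans hwW)).differentiableAt.differentiableWithinAt
    · intro y hy
      rw [interior_Icc] at hy
      have hy0 := hw'.trans hy.1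
      have hyW := hy.2.trans hwW
      rw [(hder' y hy0 hyW).deriv]
      apply div_nonpos_of_nonpos_of_nonneg _ (by positivity)
      have hk := aux_kernel ob f hfc hfmono y W hy0 hyW hW
      have hA := hApos y hy0 hyW
      have hf := hfpos y ⟨hy0, hyW.trans hW⟩
      have hsplit : ∫ x in y..W, f x * (2 * y - x - y * x / W) =
          2 * y * (∫ x in y..W, f x * (1 - x / W)) - (1 - y / W) * ∫ x in y..W, x * f x := by
        rw [← intervalIntegral.integral_const_mul, ← intervalIntegral.integral_const_mul,
          ← intervalIntegral.integral_sub]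
        · congr 1; ext x; ring
        · exact ((hc1.mono (hsub y hy0)).intervalIntegrable).const_mul _
        · exact ((hc2.mono (hsub y hy0)).intervalIntegrable).const_mul _
      rw [hsplit] at hk
      have := mul_nonpos_of_nonneg_of_nonpos (mul_pos hf hA).le hk
      simp only [Nat.cast_ofNat, Nat.add_one_sub_one, pow_one]
      nlinarith [this]
  have h := hanti ⟨le_rfl, hw'w⟩ ⟨hw'w, le_rfl⟩ hw'w
  have a1 := hApos w (by linarith) hwW
  have a2 := hApos w' hw' (by linarith)
  simp only at h
  rwa [div_le_div_iff₀ (by positivity) (by positivity)] at h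

/-- second-order sensitivity estimate for the LP threshold: reducing the
`k`-th capacity by the size `b_k·u` of a served request changes `F` at the threshold by at
most `((M−1)u²)/((c̃_k/b_k)·p·T'·μ^j(c̃)) + u/(p·T'·μ^j(c̃))`. -/
theorem stmt11
    (ob : ℝ) (hω : 0 < ob)
    (ν : Measure ℝ) [IsProbabilityMeasure ν]
    (F f : ℝ → ℝ) (hF : ∀ w, F w = (ν (Set.Ioc 0 w)).toReal)
    (hfc : ContinuousOn f (Set.Ioi 0))
    (hν : ν = (MeasureTheory.volume.restrict (Set.Ioi 0)).withDensity
      (fun w => ENNReal.ofReal (f w)))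
    (hfpos : ∀ w ∈ Set.Ioo 0 ob, 0 < f w)
    (hfmono : MonotoneOn (fun w => w ^ 3 * f w) (Set.Ioo 0 ob))
    (lam γ₁ γ₂ : ℝ) (hlam : lam ∈ Set.Ioo (0:ℝ) 1) (hγ₁ : 1 < γ₁) (hγ₁₂ : γ₁ < γ₂)
    (hreg : ∀ w ∈ Set.Ioo 0 ob, γ₁ * F (lam * w) ≤ F w ∧ F w ≤ γ₂ * F (lam * w))
    (hFpos : ∀ w ∈ Set.Ioo 0 ob, 0 < F w)
    (M : ℝ) (hM : 1 < M)
    (hMest : ∀ w₁ w₂ : ℝ, 0 < w₁ → w₁ < w₂ → w₂ < ob →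
      w₂ * (F w₂ - F w₁) ≤ M * ∫ u in Set.Ioc w₁ w₂, u ∂ν)
    (p T' : ℝ) (hp : 0 < p) (hp1 : p ≤ 1) (hT' : 0 < T')
    (m : ℕ) (hm : 1 ≤ m)
    (b : ℕ → ℝ) (hb : ∀ l ∈ Finset.Icc 1 m, 0 < b l)
    (j : ℕ) (hj : j ∈ Finset.Icc 1 m)
    (k : ℕ) (hk : k ∈ Finset.Icc 1 j)
    (μ : (ℕ → ℝ) → ℝ)
    (c : ℕ → ℝ) (hcpos : ∀ l ∈ Finset.Icc 1 m, 0 < c l)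
    (hsol : ∀ v ∈ Set.Icc (0:ℝ) (c k / b k),
      (0 ≤ μ (Function.update c k (c k - b k * v)) ∧
        μ (Function.update c k (c k - b k * v)) < ob) ∧
      p * ∫ w in (0:ℝ)..(μ (Function.update c k (c k - b k * v))), w * f w =
        (∑ l ∈ Finset.Icc 1 j, Function.update c k (c k - b k * v) l / b l) / T')
    (hμc : 0 < μ c ∧ μ c < ob)
    (hμceq : p * ∫ w in (0:ℝ)..(μ c), w * f w = (∑ l ∈ Finset.Icc 1 j, c l / b l) / T') :
    ∀ u ∈ Set.Icc (0:ℝ) (c k / b k),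
      F (μ c) - F (μ (Function.update c k (c k - b k * u))) ≤
        (M - 1) * u ^ 2 / ((c k / b k) * p * T' * μ c) + u / (p * T' * μ c) := by
  have hint : ∀ W, 0 ≤ W → W < ob → IntervalIntegrable f volume 0 W := by
    intro W h0 hW
    rw [intervalIntegrable_iff_integrableOn_Ioc_of_le h0]
    refine ⟨(hfc.mono (fun x hx => hx.1)).aestronglyMeasurable measurableSet_Ioc, ?_⟩
    rw [hasFiniteIntegral_iff_ofReal]
    · have h1 : ν (Set.Ioc 0 W) < ⊤ := measure_lt_top _ _
      rw [hν, withDensity_apply _ measurableSet_Ioc, Measure.restrict_restrict measurableSet_Ioc,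
        Set.inter_eq_left.mpr (fun x hx => hx.1)] at h1
      exact h1
    · filter_upwards [ae_restrict_mem measurableSet_Ioc] with x hx
      exact (hfpos x ⟨hx.1, hx.2.trans_lt hW⟩).le
  have hint2 : ∀ W, 0 ≤ W → W < ob → IntervalIntegrable (fun x => x * f x) volume 0 W := by
    intro W h0 hW
    exact (hint W h0 hW).continuousOn_mul continuousOn_id
  have hFint : ∀ W, 0 ≤ W → W < ob → F W = ∫ x in (0:ℝ)..W, f x := by
    intro W h0 hW
    rw [hF, intervalIntegral.integral_of_le h0, integral_eq_lintegral_of_nonneg_ae]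
    · rw [hν, withDensity_apply _ measurableSet_Ioc, Measure.restrict_restrict measurableSet_Ioc,
        Set.inter_eq_left.mpr (fun x hx => hx.1)]
    · filter_upwards [ae_restrict_mem measurableSet_Ioc] with x hx
      exact (hfpos x ⟨hx.1, hx.2.trans_lt hW⟩).le
    · exact (hfc.mono (fun x hx => hx.1)).aestronglyMeasurable measurableSet_Ioc
  have hνint : ∀ w₁ w₂, 0 < w₁ → w₁ < w₂ → w₂ < ob →
      ∫ u in Set.Ioc w₁ w₂, u ∂ν = ∫ x in w₁..w₂, x * f x := by
    intro w₁ w₂ h1 h12 h2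
    have hs : Set.Ioc w₁ w₂ ⊆ Set.Ioi 0 := fun x hx => h1.trans hx.1
    rw [hν, restrict_withDensity measurableSet_Ioc, Measure.restrict_restrict measurableSet_Ioc,
      Set.inter_eq_left.mpr hs, integral_withDensity_eq_integral_toReal_smul₀,
      intervalIntegral.integral_of_le h12.le]
    · apply setIntegral_congr_fun measurableSet_Ioc
      intro x hx
      have := (hfpos x ⟨hs hx, hx.2.trans_lt h2⟩).le
      simp only [smul_eq_mul]
      rw [ENNReal.toReal_ofReal this, mul_comm]
    · exact ((hfc.mono hs).aemeasurable measurableSet_Ioc).ennreal_ofReal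
    · exact Filter.Eventually.of_forall (fun x => ENNReal.ofReal_lt_top)
  obtain ⟨hW0, hWob⟩ := hμc
  set W := μ c with hWdef
  set G : ℝ → ℝ := fun y => ∫ x in (0:ℝ)..y, x * f x with hG
  have hGsub : ∀ x y, 0 ≤ x → x < ob → 0 ≤ y → y < ob → ∫ t in x..y, t * f t = G y - G x := by
    intro x y hx hx' hy hy'
    exact (intervalIntegral.integral_interval_sub_left (hint2 y hy hy') (hint2 x hx hx')).symm
  have hFsub : ∀ x y, 0 ≤ x → x < ob → 0 ≤ y → y < ob → ∫ t in x..y, f t = F y - F x := by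
    intro x y hx hx' hy hy'
    rw [hFint x hx hx', hFint y hy hy']
    exact (intervalIntegral.integral_interval_sub_left (hint y hy hy') (hint x hx hx')).symm
  have hGstrict : ∀ x y, 0 ≤ x → x < y → y < ob → G x < G y := by
    intro x y hx hxy hy
    have hii := (hint2 x hx (hxy.trans hy)).symm.trans (hint2 y (hx.trans hxy.le) hy)
    have := intervalIntegral.intervalIntegral_pos_of_pos_on hii (fun t ht =>
      mul_pos (hx.trans_lt ht.1) (hfpos t ⟨hx.trans_lt ht.1, ht.2.trans hy⟩)) hxy
    rw [hGsub x y hx (hxy.trans hy) (hx.trans hxy.le) hy] at this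
    linarith
  -- main inequality for positive points
  have key : ∀ w' w, 0 < w' → w' ≤ w → w < W →
      W * (F W - F w) * (G W - G w') ≤
        (M - 1) * (G W - G w) ^ 2 + (G W - G w) * (G W - G w') := by
    intro w' w h1 h2 h3
    have hr := aux_ratio ob f hfc hfpos hfmono w' w W h1 h2 h3 hWob
    have hE : ∀ y, 0 < y → y < W →
        W * ∫ x in y..W, f x * (1 - x / W) = W * (F W - F y) - (G W - G y) := by
      intro y hy hyW
      have hyob := hyW.trans hWob
      have i1 := (hint y hy.le hyob).symm.trans (hint W hW0.le hWob)
      have i2 := (hint2 y hy.le hyob).symm.trans (hint2 W hW0.le hWob)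
      rw [← hFsub y W hy.le hyob hW0.le hWob, ← hGsub y W hy.le hyob hW0.le hWob,
        ← intervalIntegral.integral_const_mul, ← intervalIntegral.integral_const_mul,
        ← intervalIntegral.integral_sub (i1.const_mul _) i2]
      congr 1; ext x; field_simp
    have hw0 : 0 < w := h1.trans_le h2
    have hw'W := h2.trans_lt h3
    rw [hGsub w' W h1.le (hw'W.trans hWob) hW0.le hWob,
      hGsub w W hw0.le (h3.trans hWob) hW0.le hWob] at hr
    have hr2 := mul_le_mul_of_nonneg_left hr hW0.le
    rw [← mul_assoc, ← mul_assoc, hE w hw0 h3, hE w' h1 hw'W] at hr2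
    have hme := hMest w' W h1 hw'W hWob
    rw [hνint w' W h1 hw'W hWob, hGsub w' W h1.le (hw'W.trans hWob) hW0.le hWob] at hme
    have hA' : 0 < G W - G w' := by linarith [hGstrict w' W h1.le hw'W hWob]
    have h4 : (W * (F W - F w') - (G W - G w')) * (G W - G w) ^ 2 ≤
        ((M - 1) * (G W - G w')) * (G W - G w) ^ 2 :=
      mul_le_mul_of_nonneg_right (by linarith) (sq_nonneg _)
    refine le_of_mul_le_mul_right ?_ hA'
    nlinarith [hr2.trans h4]
  have hcont : ∀ g : ℝ → ℝ, IntervalIntegrable g volume 0 W →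
      ContinuousOn (fun y => ∫ x in (0:ℝ)..y, g x) (Set.Icc 0 W) := by
    intro g hg
    have := intervalIntegral.continuousOn_primitive_interval' hg Set.left_mem_uIcc
    rwa [Set.uIcc_of_le hW0.le] at this
  have hGc : ContinuousOn G (Set.Icc 0 W) := hcont _ (hint2 W hW0.le hWob)
  have hFc : ContinuousOn F (Set.Icc 0 W) :=
    (hcont _ (hint W hW0.le hWob)).congr (fun y hy => hFint y hy.1 (hy.2.trans_lt hWob))
  have key0 : ∀ w' w, 0 ≤ w' → w' ≤ w → w < W →
      W * (F W - F w) * (G W - G w') ≤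
        (M - 1) * (G W - G w) ^ 2 + (G W - G w) * (G W - G w') := by
    intro w' w h1 h2 h3
    have hsh : ∀ (g : ℝ → ℝ), ContinuousOn g (Set.Icc 0 W) → ∀ y, 0 ≤ y → y ≤ w →
        Filter.Tendsto (fun e => g (y + e)) (nhdsWithin 0 (Set.Ioo 0 (W - w))) (nhds (g y)) := by
      intro g hg y hy hyw
      have h5 := hg y ⟨hy, by linarith⟩
      refine h5.tendsto.comp (tendsto_nhdsWithin_iff.mpr ⟨?_, ?_⟩)
      · have : Filter.Tendsto (fun e : ℝ => y + e) (nhds 0) (nhds (y + 0)) :=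
          (continuous_const.add continuous_id).tendsto 0
        rw [add_zero] at this
        exact this.mono_left nhdsWithin_le_nhds
      · filter_upwards [self_mem_nhdsWithin] with e he
        exact ⟨by linarith [he.1], by linarith [he.2]⟩
    have hne : (nhdsWithin (0:ℝ) (Set.Ioo 0 (W - w))).NeBot := by
      rw [nhdsWithin_Ioo_eq_nhdsGT (by linarith)]; infer_instance
    have tF := hsh F hFc w (h1.trans h2) le_rfl
    have tG := hsh G hGc w (h1.trans h2) le_rfl
    have tG' := hsh G hGc w' h1 h2
    have cA := tG.const_sub (G W)
    have cA' := tG'.const_sub (G W)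
    refine le_of_tendsto_of_tendsto (((tF.const_sub (F W)).const_mul W).mul cA')
      (((cA.pow 2).const_mul (M - 1)).add (cA.mul cA')) ?_
    filter_upwards [self_mem_nhdsWithin] with e he
    exact key (w' + e) (w + e) (by linarith [he.1]) (by linarith) (by linarith [he.2])
  have hkm : k ∈ Finset.Icc 1 m := by
    simp only [Finset.mem_Icc] at hk hj ⊢; omega
  have hbk := hb k hkm
  have hK : 0 < c k / b k := div_pos (hcpos k hkm) hbk
  have hsum : ∀ v, ∑ l ∈ Finset.Icc 1 j, Function.update c k (c k - b k * v) l / b l =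
      (∑ l ∈ Finset.Icc 1 j, c l / b l) - v := by
    intro v
    rw [← Finset.add_sum_erase _ _ hk, ← Finset.add_sum_erase _ (fun l => c l / b l) hk,
      Function.update_self]
    have : ∑ l ∈ (Finset.Icc 1 j).erase k, Function.update c k (c k - b k * v) l / b l =
        ∑ l ∈ (Finset.Icc 1 j).erase k, c l / b l := by
      apply Finset.sum_congr rfl
      intro l hl
      rw [Function.update_of_ne (Finset.ne_of_mem_erase hl)]
    rw [this]
    field_simp
    ring
  have hGv : ∀ v ∈ Set.Icc (0:ℝ) (c k / b k),
      G W - G (μ (Function.update c k (c k - b k * v))) = v / (p * T') := by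
    intro v hv
    have h1 := (hsol v hv).2
    rw [hsum v] at h1
    have h2 : p * (G W - G (μ (Function.update c k (c k - b k * v)))) = v / T' := by
      rw [mul_sub]
      simp only [hG]
      rw [h1, hμceq]
      ring
    rw [eq_div_iff (by positivity)]
    rw [eq_div_iff hT'.ne'] at h2
    linarith
  intro u hu
  rcases hu.1.eq_or_lt with h0 | hupos
  · subst h0
    simp [← hWdef]
  obtain ⟨⟨hu0, huob⟩, -⟩ := hsol u hu
  have hKmem : c k / b k ∈ Set.Icc (0:ℝ) (c k / b k) := ⟨hK.le, le_rfl⟩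
  obtain ⟨⟨hk0, hkob⟩, -⟩ := hsol _ hKmem
  have gu := hGv u hu
  have gk := hGv _ hKmem
  set w := μ (Function.update c k (c k - b k * u)) with hw
  set w' := μ (Function.update c k (c k - b k * (c k / b k))) with hw'
  have hpT : 0 < p * T' := mul_pos hp hT'
  have hwW : w < W := by
    by_contra hcon
    have : 0 < u / (p * T') := by positivity
    rcases (not_lt.mp hcon).eq_or_lt with h | h
    · rw [← h] at gu; linarith
    · have := hGstrict W w hW0.le h huob; linarith
  have hw'w : w' ≤ w := by
    by_contra hcon
    have h1 := hGstrict w w' hu0 (not_le.mp hcon) hkob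
    have h2 : u / (p * T') ≤ (c k / b k) / (p * T') := div_le_div_of_nonneg_right hu.2 hpT.le
    linarith
  have hfin := key0 w' w hk0 hw'w hwW
  rw [gu, gk] at hfin
  generalize c k / b k = K at *
  have e : (M - 1) * u ^ 2 / (K * p * T' * W) + u / (p * T' * W) =
      ((M - 1) * (u / (p * T')) ^ 2 + u / (p * T') * (K / (p * T'))) / (W * (K / (p * T'))) := by
    field_simp
  rw [e, le_div_iff₀ (by positivity)]
  linarith
end

section
/- Let n ≥ 1, let p_1,…,p_n > 0 and r_1,…,r_n > 0, and let ν_1,…,ν_n be Borel probability measures on (0,∞) with continuous densities f_i such that, for some ω̄ > 0, f_i(w) > 0 for w ∈ (0,ω̄) and w ↦ w³·f_i(w) is nondecreasing on (0,ω̄), for every i. Let A > 0, let I ⊆ (0,∞) be an interval, and suppose ν : I → (0,∞) satisfies A·Σ_{i=1}^n p_i·∫_0^{r_i·ν(s)} u·f_i(u) du = s and r_i·ν(s) ∈ (0,ω̄) for every s ∈ I and every i. Then s ↦ 1/ν(s) is convex on I. -/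
open MeasureTheory

lemma aux_int_s12 (ob : ℝ) (f : ℝ → ℝ) (hfc : ContinuousOn f (Set.Ioi 0))
    (μ : Measure ℝ) (hprob : IsProbabilityMeasure μ)
    (hν : μ = (MeasureTheory.volume.restrict (Set.Ioi 0)).withDensity
      (fun w => ENNReal.ofReal (f w)))
    (hfpos : ∀ w ∈ Set.Ioo 0 ob, 0 < f w) (b : ℝ) (hb : b ∈ Set.Ioo 0 ob) :
    IntervalIntegrable (fun w => w * f w) volume 0 b := by
  have hsub : Set.Ioc 0 b ⊆ Set.Ioi (0:ℝ) := fun x hx => hx.1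
  have h1 : ∫⁻ w in Set.Ioi (0:ℝ), ENNReal.ofReal (f w) = 1 := by
    have := hprob.measure_univ
    rw [hν, withDensity_apply _ MeasurableSet.univ] at this
    simpa using this
  have h2 : IntegrableOn f (Set.Ioc 0 b) := by
    refine ⟨(hfc.mono hsub).aestronglyMeasurable measurableSet_Ioc, ?_⟩
    rw [hasFiniteIntegral_iff_ofReal]
    · calc _ ≤ ∫⁻ w in Set.Ioi (0:ℝ), ENNReal.ofReal (f w) := lintegral_mono_set hsub
        _ < ⊤ := by rw [h1]; simp
    · filter_upwards [ae_restrict_mem measurableSet_Ioc] with w hw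
      exact (hfpos w ⟨hw.1, hw.2.trans_lt hb.2⟩).le
  rw [intervalIntegrable_iff_integrableOn_Ioc_of_le hb.1.le]
  refine Integrable.bdd_mul (c := b) h2 (by fun_prop) ?_
  filter_upwards [ae_restrict_mem measurableSet_Ioc] with w hw
  rw [Real.norm_eq_abs, abs_of_pos hw.1]; exact hw.2

lemma aux_conv (ob : ℝ) (hω : 0 < ob) (f : ℝ → ℝ) (hfc : ContinuousOn f (Set.Ioi 0))
    (μ : Measure ℝ) (hprob : IsProbabilityMeasure μ)
    (hν : μ = (MeasureTheory.volume.restrict (Set.Ioi 0)).withDensity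
      (fun w => ENNReal.ofReal (f w)))
    (hfpos : ∀ w ∈ Set.Ioo 0 ob, 0 < f w)
    (hfmono : MonotoneOn (fun w => w ^ 3 * f w) (Set.Ioo 0 ob))
    (r : ℝ) (hr : 0 < r) :
    ConvexOn ℝ (Set.Ioi (r / ob)) (fun x => ∫ w in (0:ℝ)..(r / x), w * f w) ∧
    StrictAntiOn (fun x => ∫ w in (0:ℝ)..(r / x), w * f w) (Set.Ioi (r / ob)) := by
  have hx0 : ∀ x ∈ Set.Ioi (r / ob), 0 < x := fun x hx => (div_pos hr hω).trans hx
  have hmem : ∀ x ∈ Set.Ioi (r / ob), r / x ∈ Set.Ioo 0 ob := fun x hx =>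
    ⟨div_pos hr (hx0 x hx), by
      rw [div_lt_comm₀ (hx0 x hx) hω]; exact hx⟩
  have hc : ContinuousOn (fun w => w * f w) (Set.Ioi 0) := continuousOn_id.mul hfc
  have hd : ∀ x ∈ Set.Ioi (r / ob), HasDerivAt (fun x => ∫ w in (0:ℝ)..(r / x), w * f w)
      (-(1 / r * ((r / x) ^ 3 * f (r / x)))) x := by
    intro x hx
    have hm := hmem x hx
    have h0 := hx0 x hx
    have h1 := intervalIntegral.integral_hasDerivAt_right
      (aux_int_s12 ob f hfc μ hprob hν hfpos _ hm)
      (hc.stronglyMeasurableAtFilter isOpen_Ioi _ hm.1)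
      (hc.continuousAt (isOpen_Ioi.mem_nhds hm.1))
    have h2 : HasDerivAt (fun x => r / x) (-(r / x ^ 2)) x := by
      have := (hasDerivAt_inv h0.ne').const_mul r
      simp only [← div_eq_mul_inv] at this
      refine this.congr_deriv ?_
      ring
    refine (h1.comp x h2).congr_deriv ?_
    field_simp
  have hcont : ContinuousOn (fun x => ∫ w in (0:ℝ)..(r / x), w * f w) (Set.Ioi (r / ob)) :=
    fun x hx => (hd x hx).continuousAt.continuousWithinAt
  constructor
  · refine MonotoneOn.convexOn_of_deriv (convex_Ioi _) hcont ?_ ?_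
    · rw [interior_Ioi]
      exact fun x hx => (hd x hx).differentiableAt.differentiableWithinAt
    · rw [interior_Ioi]
      intro x hx y hy hxy
      rw [(hd x hx).deriv, (hd y hy).deriv]
      have := hfmono (hmem y hy) (hmem x hx) (div_le_div_of_nonneg_left hr.le (hx0 x hx) hxy)
      exact neg_le_neg (mul_le_mul_of_nonneg_left this (by positivity))
  · refine strictAntiOn_of_deriv_neg (convex_Ioi _) hcont ?_
    rw [interior_Ioi]
    intro x hx
    rw [(hd x hx).deriv]
    have := hfpos _ (hmem x hx)
    have := (hmem x hx).1
    have : 0 < 1 / r * ((r / x) ^ 3 * f (r / x)) := by positivity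
    linarith


/-- convexity of the reciprocal of the aggregate acceptance threshold
`θ(s)` defined by `A·Σᵢ pᵢ·∫_0^{rᵢ·θ(s)} u·fᵢ(u) du = s` on an interval `I ⊆ (0,∞)`. -/
theorem stmt12
    (n : ℕ) (hn : 1 ≤ n)
    (p r : Fin n → ℝ) (hp : ∀ i, 0 < p i) (hr : ∀ i, 0 < r i)
    (ob : ℝ) (hω : 0 < ob)
    (ν : Fin n → Measure ℝ) (hprob : ∀ i, IsProbabilityMeasure (ν i))
    (f : Fin n → ℝ → ℝ) (hfc : ∀ i, ContinuousOn (f i) (Set.Ioi 0))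
    (hν : ∀ i, ν i = (MeasureTheory.volume.restrict (Set.Ioi 0)).withDensity
      (fun w => ENNReal.ofReal (f i w)))
    (hfpos : ∀ i, ∀ w ∈ Set.Ioo 0 ob, 0 < f i w)
    (hfmono : ∀ i, MonotoneOn (fun w => w ^ 3 * f i w) (Set.Ioo 0 ob))
    (A : ℝ) (hA : 0 < A)
    (I : Set ℝ) (hIconn : I.OrdConnected) (hIsub : I ⊆ Set.Ioi 0)
    (θ : ℝ → ℝ) (hθpos : ∀ s ∈ I, 0 < θ s)
    (hθ : ∀ s ∈ I, (∀ i, r i * θ s ∈ Set.Ioo 0 ob) ∧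
      A * ∑ i, p i * ∫ w in (0:ℝ)..(r i * θ s), w * f i w = s) :
    ConvexOn ℝ I (fun s => 1 / θ s) := by
  have key := fun i => aux_conv ob hω (f i) (hfc i) (ν i) (hprob i) (hν i) (hfpos i)
    (hfmono i) (r i) (hr i)
  have hdom : ∀ s ∈ I, ∀ i, 1 / θ s ∈ Set.Ioi (r i / ob) := by
    intro s hs i
    have h := ((hθ s hs).1 i).2
    rw [Set.mem_Ioi, div_lt_div_iff₀ hω (hθpos s hs)]
    linarith
  have hG : ∀ s ∈ I, A * ∑ i, p i * ∫ w in (0:ℝ)..(r i / (1 / θ s)), w * f i w = s := by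
    intro s hs
    have := (hθ s hs).2
    simpa only [div_div_eq_mul_div, div_one] using this
  have hIc : Convex ℝ I := hIconn.convex
  refine ⟨hIc, ?_⟩
  intro s hs t ht a b ha hb hab
  have hm := hIc hs ht ha hb hab
  by_contra hcon
  have hcon := not_le.mp hcon
  simp only at hcon
  have hne : (Finset.univ : Finset (Fin n)).Nonempty := ⟨⟨0, hn⟩, Finset.mem_univ _⟩
  have hlt : (∑ i, p i * ∫ w in (0:ℝ)..(r i / (1 / θ (a • s + b • t))), w * f i w) <
      ∑ i, p i * (a • (∫ w in (0:ℝ)..(r i / (1 / θ s)), w * f i w) +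
        b • (∫ w in (0:ℝ)..(r i / (1 / θ t)), w * f i w)) := by
    refine Finset.sum_lt_sum_of_nonempty hne fun i _ => mul_lt_mul_of_pos_left ?_ (hp i)
    refine lt_of_lt_of_le ?_ ((key i).1.2 (hdom s hs i) (hdom t ht i) ha hb hab)
    exact (key i).2 ((convex_Ioi _) (hdom s hs i) (hdom t ht i) ha hb hab) (hdom _ hm i) hcon
  have h1 := mul_lt_mul_of_pos_left hlt hA
  rw [hG _ hm] at h1
  have h2 : A * ∑ i, p i * (a • (∫ w in (0:ℝ)..(r i / (1 / θ s)), w * f i w) +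
        b • (∫ w in (0:ℝ)..(r i / (1 / θ t)), w * f i w)) = a • s + b • t := by
    have e1 := hG s hs
    have e2 := hG t ht
    trans (a • (A * ∑ i, p i * ∫ w in (0:ℝ)..(r i / (1 / θ s)), w * f i w) +
      b • (A * ∑ i, p i * ∫ w in (0:ℝ)..(r i / (1 / θ t)), w * f i w))
    swap
    · rw [e1, e2]
    simp only [smul_eq_mul, mul_add, Finset.sum_add_distrib, Finset.mul_sum]
    congr 1 <;> exact Finset.sum_congr rfl fun i _ => by ring
  exact absurd h1 (by rw [h2]; exact lt_irrefl _)
end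

section
/- Let n ≥ 1, let p_1,…,p_n ≥ 0, let r_1,…,r_n > 0, and let ν_1,…,ν_n be Borel probability measures on [0,∞) with finite mean and CDFs F_i(w) = ν_i([0,w]). Let T > 0, C ≥ 0, and suppose μ > 0 satisfies T·Σ_{i=1}^n p_i·∫_{(0, r_i·μ]} u dν_i(u) = C. Then for every w = (w_1,…,w_n) ∈ [0,∞)^n with T·Σ_{i=1}^n p_i·∫_{(0,w_i]} u dν_i(u) ≤ C, one has Σ_{i=1}^n p_i·r_i·F_i(w_i) ≤ Σ_{i=1}^n p_i·r_i·F_i(r_i·μ). -/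
open MeasureTheory

lemma key_aux (ν : Measure ℝ) [IsProbabilityMeasure ν]
    (hm : Integrable (fun u : ℝ => u) ν) (a w : ℝ) :
    a * (ν (Set.Icc 0 w)).toReal - ∫ u in Set.Ioc 0 w, u ∂ν
      = ∫ u, (Set.Icc 0 w).indicator (fun u => a - u) u ∂ν := by
  have h1 : ∫ u in Set.Ioc 0 w, u ∂ν = ∫ u in Set.Icc 0 w, u ∂ν := by
    rw [← integral_indicator measurableSet_Ioc, ← integral_indicator measurableSet_Icc]
    congr 1
    ext u
    simp only [Set.indicator_apply, Set.mem_Ioc, Set.mem_Icc]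
    split_ifs <;> grind
  rw [h1, integral_indicator measurableSet_Icc,
    integral_sub (integrable_const _) hm.integrableOn, setIntegral_const]
  simp [Measure.real, mul_comm]

lemma key_le (ν : Measure ℝ) [IsProbabilityMeasure ν]
    (hm : Integrable (fun u : ℝ => u) ν) (a w : ℝ) :
    a * (ν (Set.Icc 0 w)).toReal - ∫ u in Set.Ioc 0 w, u ∂ν
      ≤ a * (ν (Set.Icc 0 a)).toReal - ∫ u in Set.Ioc 0 a, u ∂ν := by
  rw [key_aux ν hm, key_aux ν hm]
  have hi : Integrable (fun u : ℝ => a - u) ν := (integrable_const _).sub hm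
  refine integral_mono (hi.indicator measurableSet_Icc) (hi.indicator measurableSet_Icc) ?_
  intro u
  simp only [Set.indicator_apply, Set.mem_Icc]
  split_ifs <;> grind

/-- among acceptance levels `w_i` obeying the aggregate expected-capacity
constraint, the reward-proportional thresholds `w_i = r_i·μ` maximize `Σᵢ pᵢ rᵢ Fᵢ(wᵢ)`. -/
theorem stmt14
    (n : ℕ) (hn : 1 ≤ n)
    (p r : Fin n → ℝ) (hp : ∀ i, 0 ≤ p i) (hr : ∀ i, 0 < r i)
    (ν : Fin n → Measure ℝ) (hprob : ∀ i, IsProbabilityMeasure (ν i))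
    (hsupp : ∀ i, (ν i) (Set.Iio 0) = 0)
    (hmean : ∀ i, Integrable (fun u : ℝ => u) (ν i))
    (F : Fin n → ℝ → ℝ) (hF : ∀ i w, F i w = ((ν i) (Set.Icc 0 w)).toReal)
    (T C : ℝ) (hT : 0 < T) (hC : 0 ≤ C)
    (μ : ℝ) (hμ : 0 < μ)
    (heq : T * ∑ i, p i * ∫ u in Set.Ioc 0 (r i * μ), u ∂(ν i) = C) :
    ∀ w : Fin n → ℝ, (∀ i, 0 ≤ w i) →
      T * ∑ i, p i * ∫ u in Set.Ioc 0 (w i), u ∂(ν i) ≤ C →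
      ∑ i, p i * r i * F i (w i) ≤ ∑ i, p i * r i * F i (r i * μ) := by
  intro w _ hle
  have h1 := le_of_mul_le_mul_left (hle.trans heq.symm.le) hT
  have h2 : ∑ i, p i * (r i * μ * F i (w i) - ∫ u in Set.Ioc 0 (w i), u ∂(ν i))
      ≤ ∑ i, p i * (r i * μ * F i (r i * μ) - ∫ u in Set.Ioc 0 (r i * μ), u ∂(ν i)) := by
    refine Finset.sum_le_sum fun i _ => mul_le_mul_of_nonneg_left ?_ (hp i)
    have := hprob i
    rw [hF, hF]
    exact key_le (ν i) (hmean i) _ _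
  simp only [mul_sub, Finset.sum_sub_distrib] at h2
  have h3 : ∀ x : Fin n → ℝ, ∑ i, p i * (r i * μ * F i (x i))
      = μ * ∑ i, p i * r i * F i (x i) := by
    intro x
    rw [Finset.mul_sum]
    exact Finset.sum_congr rfl fun i _ => by ring
  rw [h3 w, h3 (fun i => r i * μ)] at h2
  exact le_of_mul_le_mul_left (by linarith) hμ
end

section
/- Let ν be a Borel probability measure on [0,∞) with finite mean and CDF F(w) = ν([0,w]). Let y : [0,∞) → [0,1] be Borel measurable and set z := ∫ y dν. Then for every q ≥ 0 with F(q) = z: ∫ u·y(u) dν(u) ≥ ∫_{[0,q]} u dν(u). -/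
open MeasureTheory

/-- rearrangement-type lower bound: among `[0,1]`-valued acceptance rules `y`
with total acceptance probability `z`, the expected accepted size is minimized by accepting
exactly the sizes below the `z`-quantile `q`. -/
theorem stmt15
    (ν : Measure ℝ) [IsProbabilityMeasure ν] (hsupp : ν (Set.Iio 0) = 0)
    (hmean : Integrable (fun u : ℝ => u) ν)
    (F : ℝ → ℝ) (hF : ∀ w, F w = (ν (Set.Icc 0 w)).toReal)
    (y : ℝ → ℝ) (hy : Measurable y) (hy01 : ∀ u, y u ∈ Set.Icc (0:ℝ) 1)
    (z : ℝ) (hz : z = ∫ u, y u ∂ν) :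
    ∀ q : ℝ, 0 ≤ q → F q = z →
      ∫ u in Set.Icc 0 q, u ∂ν ≤ ∫ u, u * y u ∂ν := by
  intro q hq hFq
  have hyi : Integrable y ν := by
    refine Integrable.of_bound hy.aestronglyMeasurable 1 (Filter.Eventually.of_forall fun u => ?_)
    rw [Real.norm_eq_abs, abs_le]
    exact ⟨by linarith [(hy01 u).1], (hy01 u).2⟩
  have huy : Integrable (fun u => u * y u) ν := by
    refine hmean.mono (measurable_id.mul hy).aestronglyMeasurable
      (Filter.Eventually.of_forall fun u => ?_)
    rw [norm_mul]
    have h : ‖y u‖ ≤ 1 := by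
      rw [Real.norm_eq_abs, abs_le]
      exact ⟨by linarith [(hy01 u).1], (hy01 u).2⟩
    exact mul_le_of_le_one_right (norm_nonneg _) h
  have hS : MeasurableSet (Set.Icc (0:ℝ) q) := measurableSet_Icc
  have hnn : ∀ᵐ u ∂ν, 0 ≤ u := by
    rw [ae_iff]
    simpa [Set.Iio] using hsupp
  have hc : Integrable (fun u : ℝ => u - q) ν := hmean.sub (integrable_const q)
  have key : ∫ u, (Set.Icc (0:ℝ) q).indicator (fun u => u - q) u ∂ν
      ≤ ∫ u, (u * y u - q * y u) ∂ν := by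
    refine integral_mono_ae (hc.indicator hS) (huy.sub (hyi.const_mul q)) ?_
    filter_upwards [hnn] with u hu
    obtain ⟨h0, h1⟩ := hy01 u
    by_cases h : u ≤ q
    · rw [Set.indicator_of_mem (show u ∈ Set.Icc (0:ℝ) q from ⟨hu, h⟩)]
      nlinarith
    · rw [Set.indicator_of_notMem (fun hm => h hm.2)]
      push Not at h
      nlinarith
  rw [integral_indicator hS, integral_sub hmean.integrableOn (integrable_const q),
    integral_sub huy (hyi.const_mul q), integral_const_mul, setIntegral_const, ← hz,
    ← hFq, hF q, smul_eq_mul, Measure.real] at key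
  linarith
end

section
/- Let ν be a Borel probability measure on (0,∞) with continuous CDF F such that F(w) > 0 for w ∈ (0,ω̄) and, for some λ ∈ (0,1) and 1 < γ₁ < γ₂, γ₁·F(λw) ≤ F(w) ≤ γ₂·F(λw) for all w ∈ (0,ω̄); let M > 1 satisfy w₂·(F(w₂) − F(w₁)) ≤ M·∫_{(w₁,w₂]} u dν(u) for all 0 < w₁ < w₂ < ω̄. Let p ∈ (0,1], T' > 0, b_1,…,b_m > 0, c_1,…,c_m > 0, and let μ^1 ≤ μ^2 ≤ … ≤ μ^m in (0,ω̄) satisfy p·T'·∫_{(0,μ^j]} u dν(u) = Σ_{k=1}^j c_k/b_k for each j. Set h^j := min(c_j/b_j, μ^j). Let 1 = j_1 < j_2 < … < j_W ≤ m be indices with h^{j_1} ≤ h^{j_2} ≤ … ≤ h^{j_W} and such that, with j_{W+1} := m+1, h^j < h^{j_w} whenever j_w < j ≤ j_{w+1} − 1. Then for every w ∈ {1,…,W}: if c_{j_w}/b_{j_w} < μ^{j_w}, then F(μ^{j_w}) − F(h^{j_w}) ≤ M·j_w/(p·T'). -/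
open MeasureTheory

/-- for the monotone subsequence `j_1 < … < j_W` of truncated thresholds
`h^j = min(c_j/b_j, μ^j)`, if the `j_w`-th threshold is truncated by the capacity then
`F(μ^{j_w}) − F(h^{j_w}) ≤ M·j_w/(p·T')`. -/
theorem stmt17
    (ob : ℝ) (hω : 0 < ob)
    (ν : Measure ℝ) [IsProbabilityMeasure ν] (hsupp : ν (Set.Iic 0) = 0)
    (F : ℝ → ℝ) (hF : ∀ w, F w = (ν (Set.Ioc 0 w)).toReal) (hFcont : Continuous F)
    (hFpos : ∀ w ∈ Set.Ioo 0 ob, 0 < F w)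
    (lam γ₁ γ₂ : ℝ) (hlam : lam ∈ Set.Ioo (0:ℝ) 1) (hγ₁ : 1 < γ₁) (hγ₁₂ : γ₁ < γ₂)
    (hreg : ∀ w ∈ Set.Ioo 0 ob, γ₁ * F (lam * w) ≤ F w ∧ F w ≤ γ₂ * F (lam * w))
    (M : ℝ) (hM : 1 < M)
    (hMest : ∀ w₁ w₂ : ℝ, 0 < w₁ → w₁ < w₂ → w₂ < ob →
      w₂ * (F w₂ - F w₁) ≤ M * ∫ u in Set.Ioc w₁ w₂, u ∂ν)
    (p T' : ℝ) (hp : 0 < p) (hp1 : p ≤ 1) (hT' : 0 < T')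
    (m : ℕ) (hm : 1 ≤ m)
    (b c : ℕ → ℝ) (hb : ∀ j ∈ Finset.Icc 1 m, 0 < b j) (hc : ∀ j ∈ Finset.Icc 1 m, 0 < c j)
    (μ : ℕ → ℝ) (hμmem : ∀ j ∈ Finset.Icc 1 m, μ j ∈ Set.Ioo 0 ob)
    (hμmono : ∀ j k, 1 ≤ j → j ≤ k → k ≤ m → μ j ≤ μ k)
    (hμeq : ∀ j ∈ Finset.Icc 1 m,
      p * T' * ∫ u in Set.Ioc 0 (μ j), u ∂ν = ∑ k ∈ Finset.Icc 1 j, c k / b k)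
    (h : ℕ → ℝ) (hh : ∀ j, h j = min (c j / b j) (μ j))
    (W : ℕ) (hW : 1 ≤ W)
    (jseq : ℕ → ℕ) (hjseq1 : jseq 1 = 1)
    (hjseqmono : ∀ w, 1 ≤ w → w < W → jseq w < jseq (w + 1))
    (hjseqW : jseq W ≤ m) (hjtop : jseq (W + 1) = m + 1)
    (hhmono : ∀ w, 1 ≤ w → w < W → h (jseq w) ≤ h (jseq (w + 1)))
    (hgap : ∀ w ∈ Finset.Icc 1 W, ∀ j, jseq w < j → j ≤ jseq (w + 1) - 1 →
      h j < h (jseq w)) :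
    ∀ w ∈ Finset.Icc 1 W, c (jseq w) / b (jseq w) < μ (jseq w) →
      F (μ (jseq w)) - F (h (jseq w)) ≤ M * (jseq w : ℝ) / (p * T') := by
  have key : ∀ w, 1 ≤ w → w ≤ W → 1 ≤ jseq w ∧ ∀ k, 1 ≤ k → k ≤ jseq w → h k ≤ h (jseq w) := by
    intro w hw
    induction w, hw using Nat.le_induction with
    | base =>
      intro _
      refine ⟨hjseq1.ge, fun k h1 h2 => ?_⟩
      have : k = jseq 1 := by omega
      rw [this]
    | succ w hw ih =>
      intro hwW
      obtain ⟨i1, i2⟩ := ih (by omega)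
      have h3 := hjseqmono w hw (by omega)
      have h4 := hhmono w hw (by omega)
      refine ⟨by omega, fun k h1 h2 => ?_⟩
      rcases le_or_gt k (jseq w) with h5 | h5
      · exact (i2 k h1 h5).trans h4
      · rcases h2.eq_or_lt with h6 | h6
        · rw [h6]
        · exact (hgap w (Finset.mem_Icc.2 ⟨hw, by omega⟩) k h5 (by omega)).le.trans h4
  have hle : ∀ w, w ≤ W → 1 ≤ w → jseq w ≤ m := by
    intro w hw h1
    have aux : ∀ v, w ≤ v → v ≤ W → jseq w ≤ jseq v := by
      intro v hv
      induction v, hv using Nat.le_induction with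
      | base => intro _; exact le_rfl
      | succ v hv ih =>
        intro h2
        exact (ih (by omega)).trans (hjseqmono v (by omega) (by omega)).le
    exact (aux W hw le_rfl).trans hjseqW
  intro w hw hlt
  obtain ⟨hw1, hw2⟩ := Finset.mem_Icc.1 hw
  obtain ⟨hJ1, hJh⟩ := key w hw1 hw2
  have hJm := hle w hw2 hw1
  generalize jseq w = J at *
  have hJmem : J ∈ Finset.Icc 1 m := Finset.mem_Icc.2 ⟨hJ1, hJm⟩
  have hxJ : h J = c J / b J := by rw [hh]; exact min_eq_left hlt.le
  have hxpos : 0 < h J := by rw [hxJ]; exact div_pos (hc J hJmem) (hb J hJmem)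
  have hxlt : h J < μ J := by rw [hxJ]; exact hlt
  generalize h J = x at *
  have hint : ∀ a d : ℝ, IntegrableOn (fun u : ℝ => u) (Set.Ioc a d) ν := fun a d =>
    (continuous_id.integrableOn_Icc).mono_set Set.Ioc_subset_Icc_self
  have hpT : 0 < p * T' := mul_pos hp hT'
  have hI0 : 0 ≤ ∫ u in Set.Ioc 0 x, u ∂ν :=
    setIntegral_nonneg measurableSet_Ioc (fun u hu => hu.1.le)
  have claim : ∀ n : ℕ, n ≤ J → ∑ k ∈ Finset.Icc 1 n, c k / b k ≤
      n * x + p * T' * ∫ u in Set.Ioc 0 x, u ∂ν := by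
    intro n
    induction n with
    | zero => intro _; simp; positivity
    | succ n ih =>
      intro hn
      have ih := ih (by omega)
      have hk := hJh (n + 1) (by omega) hn
      rw [hh] at hk
      rcases min_le_iff.1 hk with h1 | h1
      · rw [Finset.sum_Icc_succ_top (by omega)]
        push_cast
        linarith
      · rw [← hμeq (n + 1) (Finset.mem_Icc.2 ⟨by omega, by omega⟩)]
        have h2 : ∫ u in Set.Ioc 0 (μ (n + 1)), u ∂ν ≤ ∫ u in Set.Ioc 0 x, u ∂ν := by
          apply setIntegral_mono_set (hint 0 x)
          · exact (ae_restrict_iff' measurableSet_Ioc).2 (Filter.Eventually.of_forall fun u hu => hu.1.le)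
          · exact (Set.Ioc_subset_Ioc_right h1).eventuallyLE
        have h3 := mul_le_mul_of_nonneg_left h2 hpT.le
        have h4 : 0 ≤ ((n + 1 : ℕ) : ℝ) * x := by positivity
        linarith
  have hc1 := claim J le_rfl
  rw [← hμeq J hJmem] at hc1
  have hsplit : ∫ u in Set.Ioc 0 (μ J), u ∂ν =
      (∫ u in Set.Ioc 0 x, u ∂ν) + ∫ u in Set.Ioc x (μ J), u ∂ν := by
    rw [← Set.Ioc_union_Ioc_eq_Ioc hxpos.le hxlt.le]
    exact setIntegral_union (Set.Ioc_disjoint_Ioc_of_le le_rfl) measurableSet_Ioc (hint _ _) (hint _ _)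
  rw [hsplit] at hc1
  have hest := hMest x (μ J) hxpos hxlt (hμmem J hJmem).2
  have hμpos := (hμmem J hJmem).1
  generalize (∫ u in Set.Ioc x (μ J), u ∂ν) = I at *
  have h1 : p * T' * I ≤ J * μ J := by
    have : (J : ℝ) * x ≤ J * μ J := by gcongr
    linarith
  rw [le_div_iff₀ hpT]
  refine le_of_mul_le_mul_left ?_ hμpos
  calc μ J * ((F (μ J) - F x) * (p * T')) = (μ J * (F (μ J) - F x)) * (p * T') := by ring
    _ ≤ (M * I) * (p * T') := by gcongr
    _ = M * (p * T' * I) := by ring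
    _ ≤ M * (J * μ J) := by gcongr
    _ = μ J * (M * J) := by ring
end

section
/- Let ν be a Borel probability measure on (0,∞) with continuous CDF F such that F(w) > 0 for w ∈ (0,ω̄) and, for some λ ∈ (0,1) and 1 < γ₁ < γ₂, γ₁·F(λw) ≤ F(w) ≤ γ₂·F(λw) for all w ∈ (0,ω̄); let M > 1 satisfy w₂·(F(w₂) − F(w₁)) ≤ M·∫_{(w₁,w₂]} u dν(u) for all 0 < w₁ < w₂ < ω̄. Let p ∈ (0,1], T' > 0, b_1,…,b_m > 0, c_1,…,c_m > 0, and let μ^1 ≤ μ^2 ≤ … ≤ μ^m in (0,ω̄) satisfy p·T'·∫_{(0,μ^j]} u dν(u) = Σ_{k=1}^j c_k/b_k for each j. Set h^j := min(c_j/b_j, μ^j). Let 1 = j_1 < j_2 < … < j_W ≤ m be indices with h^{j_1} ≤ h^{j_2} ≤ … ≤ h^{j_W} and such that, with j_{W+1} := m+1, h^j < h^{j_w} whenever j_w < j ≤ j_{w+1} − 1. Then for every w ∈ {1,…,W} and every j with j_w ≤ j ≤ j_{w+1} − 1: F(μ^j) − F(h^{j_w}) ≤ M·j/(p·T'). -/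
open MeasureTheory

/-- for the monotone subsequence `j_1 < … < j_W` of truncated thresholds
`h^j = min(c_j/b_j, μ^j)`, for every `j` with `j_w ≤ j ≤ j_{w+1} − 1` one has
`F(μ^j) − F(h^{j_w}) ≤ M·j/(p·T')`. -/
theorem stmt18
    (ob : ℝ) (hω : 0 < ob)
    (ν : Measure ℝ) [IsProbabilityMeasure ν] (hsupp : ν (Set.Iic 0) = 0)
    (F : ℝ → ℝ) (hF : ∀ w, F w = (ν (Set.Ioc 0 w)).toReal) (hFcont : Continuous F)
    (hFpos : ∀ w ∈ Set.Ioo 0 ob, 0 < F w)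
    (lam γ₁ γ₂ : ℝ) (hlam : lam ∈ Set.Ioo (0:ℝ) 1) (hγ₁ : 1 < γ₁) (hγ₁₂ : γ₁ < γ₂)
    (hreg : ∀ w ∈ Set.Ioo 0 ob, γ₁ * F (lam * w) ≤ F w ∧ F w ≤ γ₂ * F (lam * w))
    (M : ℝ) (hM : 1 < M)
    (hMest : ∀ w₁ w₂ : ℝ, 0 < w₁ → w₁ < w₂ → w₂ < ob →
      w₂ * (F w₂ - F w₁) ≤ M * ∫ u in Set.Ioc w₁ w₂, u ∂ν)
    (p T' : ℝ) (hp : 0 < p) (hp1 : p ≤ 1) (hT' : 0 < T')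
    (m : ℕ) (hm : 1 ≤ m)
    (b c : ℕ → ℝ) (hb : ∀ j ∈ Finset.Icc 1 m, 0 < b j) (hc : ∀ j ∈ Finset.Icc 1 m, 0 < c j)
    (μ : ℕ → ℝ) (hμmem : ∀ j ∈ Finset.Icc 1 m, μ j ∈ Set.Ioo 0 ob)
    (hμmono : ∀ j k, 1 ≤ j → j ≤ k → k ≤ m → μ j ≤ μ k)
    (hμeq : ∀ j ∈ Finset.Icc 1 m,
      p * T' * ∫ u in Set.Ioc 0 (μ j), u ∂ν = ∑ k ∈ Finset.Icc 1 j, c k / b k)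
    (h : ℕ → ℝ) (hh : ∀ j, h j = min (c j / b j) (μ j))
    (W : ℕ) (hW : 1 ≤ W)
    (jseq : ℕ → ℕ) (hjseq1 : jseq 1 = 1)
    (hjseqmono : ∀ w, 1 ≤ w → w < W → jseq w < jseq (w + 1))
    (hjseqW : jseq W ≤ m) (hjtop : jseq (W + 1) = m + 1)
    (hhmono : ∀ w, 1 ≤ w → w < W → h (jseq w) ≤ h (jseq (w + 1)))
    (hgap : ∀ w ∈ Finset.Icc 1 W, ∀ j, jseq w < j → j ≤ jseq (w + 1) - 1 →
      h j < h (jseq w)) :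
    ∀ w ∈ Finset.Icc 1 W, ∀ j, jseq w ≤ j → j ≤ jseq (w + 1) - 1 →
      F (μ j) - F (h (jseq w)) ≤ M * (j : ℝ) / (p * T') := by
  have hcls : ∀ w, 1 ≤ w → w ≤ W → 1 ≤ jseq w ∧
      ∀ k, 1 ≤ k → k ≤ jseq (w + 1) - 1 → h k ≤ h (jseq w) := by
    intro w hw1
    induction w, hw1 using Nat.le_induction with
    | base =>
      intro _
      refine ⟨hjseq1.ge, fun k hk1 hk2 => ?_⟩
      rcases hk1.eq_or_lt with e | l
      · rw [hjseq1, ← e]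
      · exact (hgap 1 (Finset.mem_Icc.2 ⟨le_rfl, hW⟩) k (by omega) hk2).le
    | succ w hw1 ih =>
      intro hwW
      obtain ⟨i1, i2⟩ := ih (by omega)
      have hm1 := hjseqmono w hw1 (by omega)
      refine ⟨by omega, fun k hk1 hk2 => ?_⟩
      rcases lt_trichotomy k (jseq (w + 1)) with l | e | l
      · exact (i2 k hk1 (by omega)).trans (hhmono w hw1 (by omega))
      · rw [e]
      · exact (hgap (w + 1) (Finset.mem_Icc.2 ⟨by omega, hwW⟩) k l hk2).le
  have hle : ∀ d w, 1 ≤ w → w + d = W → jseq w ≤ m := by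
    intro d
    induction d with
    | zero =>
      intro w _ e
      have : w = W := by omega
      rw [this]; exact hjseqW
    | succ d ih =>
      intro w hw1 e
      have h1 := ih (w + 1) (by omega) (by omega)
      have h2 := hjseqmono w hw1 (by omega)
      omega
  intro w hw j hj1 hj2
  obtain ⟨hw1, hwW⟩ := Finset.mem_Icc.1 hw
  obtain ⟨hjw1, hmax⟩ := hcls w hw1 hwW
  have hjwm := hle (W - w) w hw1 (by omega)
  have hjm : j ≤ m := by
    rcases hwW.eq_or_lt with e | l
    · rw [e, hjtop] at hj2; omega
    · have := hle (W - (w + 1)) (w + 1) (by omega) (by omega)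
      omega
  have hdiv : ∀ k, 1 ≤ k → k ≤ m → 0 < c k / b k := fun k h1 h2 =>
    div_pos (hc k (Finset.mem_Icc.2 ⟨h1, h2⟩)) (hb k (Finset.mem_Icc.2 ⟨h1, h2⟩))
  have hμpos : ∀ k, 1 ≤ k → k ≤ m → 0 < μ k := fun k h1 h2 =>
    (hμmem k (Finset.mem_Icc.2 ⟨h1, h2⟩)).1
  have hpT : 0 < p * T' := mul_pos hp hT'
  set H := h (jseq w) with hH
  have hHpos : 0 < H := by
    rw [hH, hh]; exact lt_min (hdiv _ hjw1 hjwm) (hμpos _ hjw1 hjwm)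
  have hHle : H ≤ μ j := by
    rw [hH, hh]; exact (min_le_right _ _).trans (hμmono _ _ hjw1 hj1 hjm)
  have hint : ∀ x y : ℝ, IntegrableOn (fun u : ℝ => u) (Set.Ioc x y) ν := fun x y =>
    (continuous_id.integrableOn_Icc (a := x) (b := y)).mono_set Set.Ioc_subset_Icc_self
  obtain ⟨G, hG⟩ : ∃ G : ℝ → ℝ, ∀ x, G x = ∫ u in Set.Ioc 0 x, u ∂ν := ⟨_, fun _ => rfl⟩
  have hGsub : ∀ x y, 0 < x → x ≤ y → ∫ u in Set.Ioc x y, u ∂ν = G y - G x := by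
    intro x y hx hxy
    rw [hG, hG, ← Set.Ioc_union_Ioc_eq_Ioc hx.le hxy,
      setIntegral_union (Set.Ioc_disjoint_Ioc_of_le le_rfl) measurableSet_Ioc (hint _ _)
        (hint _ _)]
    ring
  have hGmono : ∀ x y, 0 < x → x ≤ y → G x ≤ G y := by
    intro x y hx hxy
    have := hGsub x y hx hxy
    have h2 : 0 ≤ ∫ u in Set.Ioc x y, u ∂ν :=
      setIntegral_nonneg measurableSet_Ioc fun u hu => (hx.trans hu.1).le
    linarith
  have hGH : 0 ≤ G H := by
    rw [hG]; exact setIntegral_nonneg measurableSet_Ioc fun u hu => hu.1.le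
  have hGeq : ∀ k, 1 ≤ k → k ≤ m → p * T' * G (μ k) = ∑ i ∈ Finset.Icc 1 k, c i / b i := by
    intro k h1 h2
    rw [hG]; exact hμeq k (Finset.mem_Icc.2 ⟨h1, h2⟩)
  have hcase : ∀ n, 1 ≤ n → n ≤ j → μ n < c n / b n →
      p * T' * (G (μ n) - G H) ≤ n * μ n := by
    intro n h1 h2 hlt
    have h3 := hmax n h1 (by omega)
    rw [hh n, min_eq_right hlt.le] at h3
    have h4 := hGmono _ _ (hμpos n h1 (by omega)) h3
    have h5 : p * T' * (G (μ n) - G H) ≤ 0 :=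
      mul_nonpos_of_nonneg_of_nonpos hpT.le (by linarith)
    have h6 : 0 ≤ (n : ℝ) * μ n := mul_nonneg (Nat.cast_nonneg _) (hμpos n h1 (by omega)).le
    linarith
  have key : ∀ n, 1 ≤ n → n ≤ j → p * T' * (G (μ n) - G H) ≤ n * μ n := by
    intro n hn1
    induction n, hn1 using Nat.le_induction with
    | base =>
      intro hn
      rcases lt_or_ge (μ 1) (c 1 / b 1) with l | l
      · exact hcase 1 le_rfl hn l
      · have := hGeq 1 le_rfl hm
        simp only [Finset.Icc_self, Finset.sum_singleton] at this
        have h2 := mul_nonneg hpT.le hGH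
        push_cast
        linarith
    | succ n hn1 ih =>
      intro hn
      rcases lt_or_ge (μ (n + 1)) (c (n + 1) / b (n + 1)) with l | l
      · exact hcase (n + 1) (by omega) hn l
      · have e1 := hGeq n hn1 (by omega)
        have e2 := hGeq (n + 1) (by omega) (by omega)
        rw [Finset.sum_Icc_succ_top (by omega), ← e1] at e2
        have i := ih (by omega)
        have mm := mul_le_mul_of_nonneg_left
          (hμmono n (n + 1) hn1 (by omega) (by omega)) (Nat.cast_nonneg (α := ℝ) n)
        push_cast
        linarith
  have hj : 1 ≤ j := hjw1.trans hj1
  rcases hHle.eq_or_lt with e | l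
  · rw [← e, sub_self]; positivity
  · have hmem := hμmem j (Finset.mem_Icc.2 ⟨hj, hjm⟩)
    have h1 := hMest H (μ j) hHpos l hmem.2
    rw [hGsub _ _ hHpos hHle] at h1
    have h2 := key j hj le_rfl
    rw [le_div_iff₀ hpT]
    refine le_of_mul_le_mul_left ?_ hmem.1
    calc μ j * ((F (μ j) - F H) * (p * T')) = (μ j * (F (μ j) - F H)) * (p * T') := by ring
      _ ≤ (M * (G (μ j) - G H)) * (p * T') := mul_le_mul_of_nonneg_right h1 hpT.le
      _ = M * (p * T' * (G (μ j) - G H)) := by ring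
      _ ≤ M * (j * μ j) := mul_le_mul_of_nonneg_left h2 (by linarith)
      _ = μ j * (M * j) := by ring
end

section
/- Let ν be a Borel probability measure on (0,∞) with continuous CDF F. Let p ∈ (0,1], T' > 0, b_1,…,b_m > 0, c_1,…,c_m > 0, and let μ^1 ≤ μ^2 ≤ … ≤ μ^m in (0,∞) satisfy p·T'·∫_{(0,μ^j]} u dν(u) = Σ_{k=1}^j c_k/b_k for each j. Set h^j := min(c_j/b_j, μ^j). Let 1 = j_1 < j_2 < … < j_W ≤ m be indices with h^{j_1} ≤ h^{j_2} ≤ … ≤ h^{j_W} and such that, with j_{W+1} := m+1, h^j < h^{j_w} whenever j_w < j ≤ j_{w+1} − 1; set h^{j_0} := 0. Then for every w ∈ {1,…,W}: (b_{j_w}/c_{j_w})·∫_{(h^{j_{w-1}}, h^{j_w}]} u dν(u) ≤ j_w/(p·T'). -/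
open MeasureTheory

/-- for the monotone subsequence `j_1 < … < j_W` of truncated thresholds
`h^j = min(c_j/b_j, μ^j)` (with `h^{j_0} := 0`),
`(b_{j_w}/c_{j_w})·∫_{(h^{j_{w-1}}, h^{j_w}]} u dν(u) ≤ j_w/(p·T')`. -/
theorem stmt19
    (ν : Measure ℝ) [IsProbabilityMeasure ν] (hsupp : ν (Set.Iic 0) = 0)
    (F : ℝ → ℝ) (hF : ∀ w, F w = (ν (Set.Ioc 0 w)).toReal) (hFcont : Continuous F)
    (p T' : ℝ) (hp : 0 < p) (hp1 : p ≤ 1) (hT' : 0 < T')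
    (m : ℕ) (hm : 1 ≤ m)
    (b c : ℕ → ℝ) (hb : ∀ j ∈ Finset.Icc 1 m, 0 < b j) (hc : ∀ j ∈ Finset.Icc 1 m, 0 < c j)
    (μ : ℕ → ℝ) (hμpos : ∀ j ∈ Finset.Icc 1 m, 0 < μ j)
    (hμmono : ∀ j k, 1 ≤ j → j ≤ k → k ≤ m → μ j ≤ μ k)
    (hμeq : ∀ j ∈ Finset.Icc 1 m,
      p * T' * ∫ u in Set.Ioc 0 (μ j), u ∂ν = ∑ k ∈ Finset.Icc 1 j, c k / b k)
    (h : ℕ → ℝ) (hh0 : h 0 = 0) (hh : ∀ j, 1 ≤ j → h j = min (c j / b j) (μ j))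
    (W : ℕ) (hW : 1 ≤ W)
    (jseq : ℕ → ℕ) (hjseq0 : jseq 0 = 0) (hjseq1 : jseq 1 = 1)
    (hjseqmono : ∀ w, 1 ≤ w → w < W → jseq w < jseq (w + 1))
    (hjseqW : jseq W ≤ m) (hjtop : jseq (W + 1) = m + 1)
    (hhmono : ∀ w, 1 ≤ w → w < W → h (jseq w) ≤ h (jseq (w + 1)))
    (hgap : ∀ w ∈ Finset.Icc 1 W, ∀ j, jseq w < j → j ≤ jseq (w + 1) - 1 →
      h j < h (jseq w)) :
    ∀ w ∈ Finset.Icc 1 W,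
      (b (jseq w) / c (jseq w)) * ∫ u in Set.Ioc (h (jseq (w - 1))) (h (jseq w)), u ∂ν ≤
        (jseq w : ℝ) / (p * T') := by
  intro w hw
  rw [Finset.mem_Icc] at hw
  obtain ⟨hw1, hwW⟩ := hw
  -- range of jseq
  have hle : ∀ d, d < W → jseq (W - d) ≤ m := by
    intro d
    induction d with
    | zero => intro _; simpa using hjseqW
    | succ d ih =>
      intro hd
      have h1 := ih (by omega)
      have h2 := hjseqmono (W - (d + 1)) (by omega) (by omega)
      have h3 : W - (d + 1) + 1 = W - d := by omega
      rw [h3] at h2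
      omega
  have hJm : ∀ v, 1 ≤ v → v ≤ W → jseq v ≤ m := by
    intro v h1 h2
    have := hle (W - v) (by omega)
    rwa [show W - (W - v) = v by omega] at this
  have hJ1 : ∀ v, 1 ≤ v → v ≤ W → 1 ≤ jseq v := by
    intro v h1
    induction v, h1 using Nat.le_induction with
    | base => intro _; omega
    | succ v hv ih =>
      intro h2
      have := hjseqmono v hv (by omega)
      omega
  -- running maximum
  have hmax : ∀ v, 1 ≤ v → v ≤ W → ∀ j, 1 ≤ j → j < jseq (v + 1) → h j ≤ h (jseq v) := by
    intro v h1
    induction v, h1 using Nat.le_induction with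
    | base =>
      intro h2 j hj1 hj2
      rcases Nat.lt_or_ge 1 j with hj | hj
      · exact (hgap 1 (Finset.mem_Icc.2 ⟨le_refl _, h2⟩) j (by omega) (by omega)).le
      · rw [hjseq1, show j = 1 by omega]
    | succ v hv ih =>
      intro h2 j hj1 hj2
      rcases lt_trichotomy j (jseq (v + 1)) with hj | hj | hj
      · exact (ih (by omega) j hj1 hj).trans (hhmono v hv (by omega))
      · rw [hj]
      · exact (hgap (v + 1) (Finset.mem_Icc.2 ⟨by omega, h2⟩) j hj (by omega)).le
  have hprev : ∀ j, 1 ≤ j → j < jseq w → h j ≤ h (jseq (w - 1)) := by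
    intro j hj1 hj2
    rcases Nat.lt_or_ge 1 w with h1 | h1
    · exact hmax (w - 1) (by omega) (by omega) j hj1 (by rwa [show w - 1 + 1 = w by omega])
    · have : w = 1 := by omega
      subst this
      omega
  have hrpos : ∀ j, 1 ≤ j → j ≤ m → 0 < c j / b j := fun j h1 h2 =>
    div_pos (hc j (Finset.mem_Icc.2 ⟨h1, h2⟩)) (hb j (Finset.mem_Icc.2 ⟨h1, h2⟩))
  have hprev0 : 0 ≤ h (jseq (w - 1)) := by
    rcases Nat.lt_or_ge 1 w with h1 | h1
    · have a1 := hJ1 (w - 1) (by omega) (by omega)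
      have a2 := hJm (w - 1) (by omega) (by omega)
      rw [hh _ a1]
      exact le_min (hrpos _ a1 a2).le (hμpos _ (Finset.mem_Icc.2 ⟨a1, a2⟩)).le
    · rw [show w - 1 = 0 by omega, hjseq0, hh0]
  have hprevle : 1 < w → h (jseq (w - 1)) ≤ h (jseq w) := by
    intro h1
    have := hhmono (w - 1) (by omega) (by omega)
    rwa [show w - 1 + 1 = w by omega] at this
  have hw1J : w = 1 → jseq w = 1 := by rintro rfl; exact hjseq1
  have hJ1' := hJ1 w hw1 hwW
  have hJm' := hJm w hw1 hwW
  generalize hA : h (jseq (w - 1)) = A at *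
  generalize jseq w = J at *
  have hJpos := hrpos J hJ1' hJm'
  have hhJ := hh J hJ1'
  -- the last index with a larger ratio
  obtain ⟨k, M, hkJ, hM0, hMA, hMμ, hMS, hkr⟩ : ∃ (k : ℕ) (M : ℝ), k ≤ J ∧ 0 ≤ M ∧ M ≤ A ∧ M ≤ μ J ∧
      p * T' * ∫ u in Set.Ioc 0 M, u ∂ν = ∑ i ∈ Finset.Icc 1 k, c i / b i ∧
      ∀ i, k < i → i ≤ J → c i / b i ≤ c J / b J := by
    classical
    have hgr : ∀ i, Nat.findGreatest (fun k => 1 ≤ k ∧ c J / b J < c k / b k) J < i → i ≤ J →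
        c i / b i ≤ c J / b J := by
      intro i h1 h2
      have := Nat.findGreatest_is_greatest h1 h2
      by_contra h3
      exact this ⟨by omega, not_le.1 h3⟩
    have hfl := Nat.findGreatest_le (P := fun k => 1 ≤ k ∧ c J / b J < c k / b k) J
    rcases Nat.eq_zero_or_pos (Nat.findGreatest (fun k => 1 ≤ k ∧ c J / b J < c k / b k) J)
      with h0 | h0
    · rw [h0] at hgr
      exact ⟨0, 0, by omega, le_refl _, hprev0, (hμpos J (Finset.mem_Icc.2 ⟨hJ1', hJm'⟩)).le,
        by simp, hgr⟩
    · have hs := Nat.findGreatest_of_ne_zero rfl h0.ne'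
      generalize Nat.findGreatest (fun k => 1 ≤ k ∧ c J / b J < c k / b k) J = k at *
      obtain ⟨hk1, hk2⟩ := hs
      have hkm : k ∈ Finset.Icc 1 m := Finset.mem_Icc.2 ⟨hk1, by omega⟩
      have hkne : k ≠ J := by rintro rfl; exact lt_irrefl _ hk2
      have hklt : k < J := by omega
      have hw' : 1 < w := by
        by_contra hcon
        have := hw1J (by omega)
        omega
      have e1 := hprev k hk1 hklt
      have e2 := hprevle hw'
      have e3 : h J ≤ c J / b J := hhJ ▸ min_le_left _ _
      have e4 : μ k ≤ A := by
        rw [hh k hk1] at e1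
        rcases min_le_iff.1 e1 with e | e
        · linarith
        · exact e
      exact ⟨k, μ k, hfl, (hμpos k hkm).le, e4, hμmono k J hk1 hfl hJm', hμeq k hkm, hgr⟩
  have hint : ∀ x y : ℝ, IntegrableOn (fun u : ℝ => u) (Set.Ioc x y) ν := fun x y =>
    (continuous_id.integrableOn_Icc (a := x) (b := y)).mono_set Set.Ioc_subset_Icc_self
  have hsplit : ∫ u in Set.Ioc 0 (μ J), u ∂ν =
      (∫ u in Set.Ioc 0 M, u ∂ν) + ∫ u in Set.Ioc M (μ J), u ∂ν := by
    rw [← Set.Ioc_union_Ioc_eq_Ioc hM0 hMμ]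
    exact setIntegral_union (Set.Ioc_disjoint_Ioc_of_le le_rfl) measurableSet_Ioc
      (hint _ _) (hint _ _)
  have hmono : ∫ u in Set.Ioc A (h J), u ∂ν ≤ ∫ u in Set.Ioc M (μ J), u ∂ν := by
    refine setIntegral_mono_set (hint _ _) ?_ ?_
    · filter_upwards [ae_restrict_mem measurableSet_Ioc] with u hu
      exact hM0.trans hu.1.le
    · exact (Set.Ioc_subset_Ioc hMA (hhJ ▸ min_le_right _ _)).eventuallyLE
  have hsum : ∑ i ∈ Finset.Icc 1 J, c i / b i =
      ∑ i ∈ Finset.Icc 1 k, c i / b i + ∑ i ∈ Finset.Ioc k J, c i / b i := by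
    rw [← Finset.sum_union]
    · congr 1
      ext i
      simp only [Finset.mem_union, Finset.mem_Icc, Finset.mem_Ioc]
      omega
    · rw [Finset.disjoint_left]
      intro i
      simp only [Finset.mem_Icc, Finset.mem_Ioc]
      omega
  have hbound : ∑ i ∈ Finset.Ioc k J, c i / b i ≤ J * (c J / b J) := by
    have h1 : ∑ i ∈ Finset.Ioc k J, c i / b i ≤ (Finset.Ioc k J).card • (c J / b J) := by
      refine Finset.sum_le_card_nsmul _ _ _ ?_
      intro i hi
      rw [Finset.mem_Ioc] at hi
      exact hkr i hi.1 hi.2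
    rw [nsmul_eq_mul, Nat.card_Ioc] at h1
    have h2 : ((J - k : ℕ) : ℝ) ≤ J := by exact_mod_cast Nat.sub_le J k
    exact h1.trans (mul_le_mul_of_nonneg_right h2 hJpos.le)
  have hμJ := hμeq J (Finset.mem_Icc.2 ⟨hJ1', hJm'⟩)
  rw [hsplit, mul_add, hMS, hsum] at hμJ
  have hpT : 0 < p * T' := mul_pos hp hT'
  have hfin : p * T' * ∫ u in Set.Ioc A (h J), u ∂ν ≤ J * (c J / b J) := by
    have := mul_le_mul_of_nonneg_left hmono hpT.le
    linarith
  rw [le_div_iff₀ hpT, ← inv_div, inv_mul_eq_div, div_mul_eq_mul_div, div_le_iff₀ hJpos]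
  linarith
end
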